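/- Let δ ≥ 1 and T > 0 with Tδ ≤ c for a small absolute constant c. Let b : ℝ → ℂ be smooth, supported in [−Tδ²/4, Tδ²/4], and satisfying |b^{(N)}(s)| ≤ C_N (1+|s|)^{1/2−N} for all N. Let θ ⊂ ℝ × ℤ be a rectangle [mδ,(m+1)δ] × ([nδ,(n+1)δ] ∩ ℤ) with dist((0,0), θ) ≥ Cδ for a large constant C, and let χ_θ be a smooth cutoff adapted to θ. Then the operator V(G)(y) = δ^{−2} ∫_{ℝ×ℤ} ∫_ℝ e^{2πi δ^{−2} s (y−w)·y} b(s) χ_θ(y) χ_θ(w) G(w) ds dw is bounded on L²(ℝ×ℤ) with operator norm bounded by a constant independent of δ, T, m, n. -/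

import Mathlib

open Real MeasureTheory
open scoped ENNReal

/-- Lebesgue × counting measure on `ℝ × ℤ`. -/
noncomputable def muZ : Measure (ℝ × ℤ) :=
  (volume : Measure ℝ).prod Measure.count

/-- A `δ`-cube `[mδ,(m+1)δ] × ([nδ,(n+1)δ] ∩ ℤ)` in `ℝ × ℤ`. -/
def cube (δ : ℝ) (m n : ℤ) : Set (ℝ × ℤ) :=
  {p | (m : ℝ) * δ ≤ p.1 ∧ p.1 ≤ ((m : ℝ) + 1) * δ ∧
       (n : ℝ) * δ ≤ (p.2 : ℝ) ∧ (p.2 : ℝ) ≤ ((n : ℝ) + 1) * δ}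

/-- Euclidean dot product on `ℝ × ℤ ⊂ ℝ²`. -/
def dotZ (y w : ℝ × ℤ) : ℝ := y.1 * w.1 + (y.2 : ℝ) * (w.2 : ℝ)

/-- The smooth cutoff adapted to the `δ`-cube, built from a fixed profile `ρ`. -/
noncomputable def cutoff (ρ : ℝ → ℝ) (δ : ℝ) (m n : ℤ) (p : ℝ × ℤ) : ℝ :=
  ρ (p.1 / δ - m) * ρ ((p.2 : ℝ) / δ - n)

open scoped FourierTransform ContDiff SchwartzMap in
/-- The `L²` Fourier transform agrees with the Fourier integral on `L¹ ∩ L²`. -/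
theorem fourier_toLp_ae_eq {f : ℝ → ℂ} (h1 : Integrable f) (h2 : MemLp f 2) :
    (𝓕 (h2.toLp f) : Lp ℂ 2 (volume : Measure ℝ)) =ᵐ[volume] 𝓕 f := by
  have hcont : Continuous (𝓕 f) :=
    VectorFourier.fourierIntegral_continuous Real.continuous_fourierChar
      (by exact continuous_inner) h1
  generalize hF : (𝓕 (h2.toLp f) : Lp ℂ 2 (volume : Measure ℝ)) = F
  have hL : LocallyIntegrable (F : ℝ → ℂ) volume :=
    (Lp.memLp F).locallyIntegrable one_le_two
  refine ae_eq_of_integral_contDiff_smul_eq hL hcont.locallyIntegrable fun g hg hgc ↦ ?_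
  have hgc' : HasCompactSupport (fun x ↦ (g x : ℂ)) := hgc.comp_left Complex.ofReal_zero
  have hg' : ContDiff ℝ ∞ (fun x ↦ (g x : ℂ)) := Complex.ofRealCLM.contDiff.comp hg
  obtain ⟨φ, hφ⟩ : ∃ φ : 𝓢(ℝ, ℂ), ∀ x, φ x = (g x : ℂ) := ⟨hgc'.toSchwartzMap hg', fun x ↦ rfl⟩
  have key := congrArg (fun u : 𝓢'(ℝ, ℂ) ↦ u φ)
    (Lp.fourier_toTemperedDistribution_eq (h2.toLp f))
  simp only [TemperedDistribution.fourier_apply, Lp.toTemperedDistribution_apply, hφ, hF] at key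
  calc ∫ x, g x • F x
      = ∫ x, (g x : ℂ) • F x := by
        simp [Complex.real_smul]
    _ = ∫ x, 𝓕 φ x • f x := by
        rw [← key]
        refine integral_congr_ae ?_
        filter_upwards [h2.coeFn_toLp] with x hx
        rw [hx]
    _ = ∫ x, (g x : ℂ) • 𝓕 f x := by
        have := VectorFourier.integral_fourierIntegral_smul_eq_flip (L := innerₗ ℝ)
          Real.continuous_fourierChar continuous_inner (φ.integrable (μ := volume)) h1
        rw [SchwartzMap.fourier_coe]
        simpa [hφ] using! this
    _ = ∫ x, g x • 𝓕 f x := by simp [Complex.real_smul]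

open scoped FourierTransform in
/-- Plancherel's theorem for the Fourier integral of a function in `L¹ ∩ L²`. -/
theorem lintegral_enorm_sq_fourier {f : ℝ → ℂ} (h1 : Integrable f) (h2 : MemLp f 2) :
    ∫⁻ ξ, ‖𝓕 f ξ‖ₑ ^ 2 = ∫⁻ x, ‖f x‖ₑ ^ 2 := by
  have h : eLpNorm (𝓕 f) 2 volume = eLpNorm f 2 volume := by
    rw [← eLpNorm_congr_ae (fourier_toLp_ae_eq h1 h2), ← eLpNorm_congr_ae h2.coeFn_toLp,
      ← Lp.enorm_def, ← Lp.enorm_def, ← ofReal_norm, ← ofReal_norm, Lp.norm_fourier_eq]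
  have h' := congrArg (fun t : ℝ≥0∞ ↦ t ^ (2 : ℕ)) h
  have := eLpNorm_nnreal_pow_eq_lintegral (f := f) (μ := volume) (p := 2) (by norm_num)
  have h3 := eLpNorm_nnreal_pow_eq_lintegral (f := 𝓕 f) (μ := volume) (p := 2) (by norm_num)
  norm_num at this h3
  rw [← h3, ← this, h]

theorem ENNReal.add_sq_le_two_mul (a b : ℝ≥0∞) : (a + b) ^ 2 ≤ 2 * (a ^ 2 + b ^ 2) := by
  rcases eq_or_ne a ⊤ with rfl | ha
  · simp
  rcases eq_or_ne b ⊤ with rfl | hb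
  · simp
  lift a to NNReal using ha
  lift b to NNReal using hb
  norm_cast
  exact _root_.add_sq_le

theorem lintegral_sq_le_measure_mul {α : Type*} [MeasurableSpace α] (μ : Measure α)
    {f : α → ℝ≥0∞} (hf : AEMeasurable f μ) :
    (∫⁻ x, f x ∂μ) ^ 2 ≤ μ Set.univ * ∫⁻ x, f x ^ 2 ∂μ := by
  have h := ENNReal.lintegral_mul_le_Lp_mul_Lq μ Real.HolderConjugate.two_two hf
    (aemeasurable_const (b := (1 : ℝ≥0∞)))
  simp only [Pi.mul_apply, mul_one, ENNReal.rpow_two, one_pow, lintegral_const, one_mul] at h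
  calc (∫⁻ x, f x ∂μ) ^ 2
      ≤ ((∫⁻ x, f x ^ 2 ∂μ) ^ (1 / 2 : ℝ) * μ Set.univ ^ (1 / 2 : ℝ)) ^ 2 := by gcongr
    _ = _ := by
        rw [mul_pow, ← ENNReal.rpow_two, ← ENNReal.rpow_two, ← ENNReal.rpow_mul,
          ← ENNReal.rpow_mul]
        norm_num [mul_comm]

/-- A Sobolev-type bound of a point value by `L²` norms over an interval. -/
theorem enorm_sq_le_lintegral_add_deriv {f f' : ℝ → ℂ} {a l : ℝ}
    (hf : ∀ t ∈ Set.Icc a (a + l), HasDerivAt f (f' t) t)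
    (hf' : ContinuousOn f' (Set.Icc a (a + l))) {x : ℝ} (hx : x ∈ Set.Icc a (a + l)) :
    ENNReal.ofReal l * ‖f x‖ₑ ^ 2 ≤ 2 * (∫⁻ t in Set.Icc a (a + l), ‖f t‖ₑ ^ 2)
      + 2 * ENNReal.ofReal l ^ 2 * ∫⁻ t in Set.Icc a (a + l), ‖f' t‖ₑ ^ 2 := by
  set I := Set.Icc a (a + l) with hI
  set D := ∫⁻ t in I, ‖f' t‖ₑ with hD
  have hvol : (volume.restrict I) Set.univ = ENNReal.ofReal l := by
    simp [hI]
  have hpt : ∀ t ∈ I, ‖f x‖ₑ ≤ ‖f t‖ₑ + D := by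
    intro t ht
    have hsub : Set.uIcc t x ⊆ I := Set.uIcc_subset_Icc ht hx
    have h1 : ∫ u in t..x, f' u = f x - f t :=
      intervalIntegral.integral_eq_sub_of_hasDerivAt (fun u hu ↦ hf u (hsub hu))
        ((hf'.mono hsub).intervalIntegrable)
    have h2 : ‖f x - f t‖ₑ ≤ D := by
      rw [← h1, ← ofReal_norm, intervalIntegral.norm_intervalIntegral_eq, ofReal_norm]
      refine (enorm_integral_le_lintegral_enorm _).trans ?_
      exact lintegral_mono_set (Set.uIoc_subset_uIcc.trans hsub)
    calc ‖f x‖ₑ = ‖f t + (f x - f t)‖ₑ := by congr 1; ring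
      _ ≤ ‖f t‖ₑ + ‖f x - f t‖ₑ := enorm_add_le _ _
      _ ≤ _ := by gcongr
  have hD2 : D ^ 2 ≤ ENNReal.ofReal l * ∫⁻ t in I, ‖f' t‖ₑ ^ 2 := by
    rw [← hvol]
    exact lintegral_sq_le_measure_mul _
      (hf'.aestronglyMeasurable measurableSet_Icc).enorm
  calc ENNReal.ofReal l * ‖f x‖ₑ ^ 2 = ∫⁻ _ in I, ‖f x‖ₑ ^ 2 := by
        rw [lintegral_const, hvol, mul_comm]
    _ ≤ ∫⁻ t in I, (2 * ‖f t‖ₑ ^ 2 + 2 * D ^ 2) := by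
        refine setLIntegral_mono' measurableSet_Icc fun t ht ↦ ?_
        rw [← mul_add]
        exact (pow_le_pow_left' (hpt t ht) 2).trans (ENNReal.add_sq_le_two_mul _ _)
    _ = 2 * (∫⁻ t in I, ‖f t‖ₑ ^ 2) + 2 * D ^ 2 * ENNReal.ofReal l := by
        rw [lintegral_add_right _ measurable_const, lintegral_const_mul' _ _ (by simp),
          lintegral_const, hvol]
    _ ≤ 2 * (∫⁻ t in I, ‖f t‖ₑ ^ 2)
        + 2 * (ENNReal.ofReal l * ∫⁻ t in I, ‖f' t‖ₑ ^ 2) * ENNReal.ofReal l := by gcongr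
    _ = _ := by ring

/-- Differentiation under the integral sign for a jointly continuous family whose members vanish
off a fixed compact interval. -/
theorem hasDerivAt_integral_of_continuousOn {U : Set ℝ} (hU : IsOpen U) {L : ℝ}
    {ψ ψ' : ℝ → ℝ → ℂ}
    (h0 : ∀ t ∈ U, ∀ x ∉ Set.Icc (-L) L, ψ t x = 0)
    (h0' : ∀ t ∈ U, ∀ x ∉ Set.Icc (-L) L, ψ' t x = 0)
    (hc : ContinuousOn (Function.uncurry ψ) (U ×ˢ Set.univ))
    (hc' : ContinuousOn (Function.uncurry ψ') (U ×ˢ Set.univ))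
    (hd : ∀ t ∈ U, ∀ x, HasDerivAt (fun s ↦ ψ s x) (ψ' t x) t) :
    (∀ t ∈ U, HasDerivAt (fun s ↦ ∫ x, ψ s x) (∫ x, ψ' t x) t) ∧
      ContinuousOn (fun t ↦ ∫ x, ψ' t x) U := by
  have hslice : ∀ (φ : ℝ → ℝ → ℂ), ContinuousOn (Function.uncurry φ) (U ×ˢ Set.univ) →
      ∀ t ∈ U, Continuous (φ t) := by
    intro φ hφ t ht
    rw [← continuousOn_univ]
    exact hφ.comp (f := fun x : ℝ ↦ (t, x)) (by fun_prop) (fun x _ ↦ ⟨ht, trivial⟩)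
  have hset : ∀ (φ : ℝ → ℝ → ℂ) t, (∀ x ∉ Set.Icc (-L) L, φ t x = 0) →
      ∫ x, φ t x = ∫ x in Set.Icc (-L) L, φ t x := fun φ t h ↦
    (setIntegral_eq_integral_of_forall_compl_eq_zero h).symm
  have main : ∀ t ∈ U, HasDerivAt (fun s ↦ ∫ x, ψ s x) (∫ x, ψ' t x) t ∧
      ContinuousAt (fun t ↦ ∫ x, ψ' t x) t := by
    intro t ht
    obtain ⟨ε, hε, hεU⟩ := Metric.nhds_basis_closedBall.mem_iff.1 (hU.mem_nhds ht)
    have hK : IsCompact (Metric.closedBall t ε ×ˢ Set.Icc (-L) L) :=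
      (isCompact_closedBall t ε).prod isCompact_Icc
    obtain ⟨M, hM⟩ := hK.exists_bound_of_continuousOn
      (hc'.mono (Set.prod_mono hεU (Set.subset_univ _)))
    have hball : Metric.ball t ε ∈ nhds t := Metric.ball_mem_nhds t hε
    have hbU : Metric.ball t ε ⊆ U := Metric.ball_subset_closedBall.trans hεU
    have hbound : ∀ᵐ x ∂volume.restrict (Set.Icc (-L) L), ∀ s ∈ Metric.ball t ε,
        ‖ψ' s x‖ ≤ M := by
      filter_upwards [ae_restrict_mem measurableSet_Icc] with x hx s hs
      exact hM (s, x) ⟨Metric.ball_subset_closedBall hs, hx⟩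
    constructor
    · rw [hset ψ' t (h0' t ht)]
      have := (hasDerivAt_integral_of_dominated_loc_of_deriv_le (𝕜 := ℝ)
        (μ := volume.restrict (Set.Icc (-L) L)) (F := ψ) (F' := ψ') (x₀ := t)
        (bound := fun _ ↦ M) hball
        (by filter_upwards [hball] with s hs
            exact (hslice ψ hc s (hbU hs)).aestronglyMeasurable)
        ((hslice ψ hc t ht).integrableOn_Icc)
        (hslice ψ' hc' t ht).aestronglyMeasurable hbound (integrable_const M)
        (by filter_upwards with x s hs
            exact hd s (hbU hs) x)).2
      refine this.congr_of_eventuallyEq ?_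
      filter_upwards [hball] with s hs
      exact hset ψ s (h0 s (hbU hs))
    · have : ContinuousAt (fun t ↦ ∫ x in Set.Icc (-L) L, ψ' t x) t := by
        refine continuousAt_of_dominated (bound := fun _ ↦ M) ?_ ?_ (integrable_const M) ?_
        · filter_upwards [hball] with s hs
          exact (hslice ψ' hc' s (hbU hs)).aestronglyMeasurable
        · filter_upwards [hball] with s hs
          filter_upwards [hbound] with x hx using hx s hs
        · filter_upwards with x
          have : ContinuousAt (Function.uncurry ψ') (t, x) :=
            hc'.continuousAt ((hU.prod isOpen_univ).mem_nhds ⟨ht, trivial⟩)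
          exact this.comp (f := fun s : ℝ ↦ (s, x)) (by fun_prop)
      refine this.congr ?_
      filter_upwards [hball] with s hs
      exact (hset ψ' s (h0' s (hbU hs))).symm
  exact ⟨fun t ht ↦ (main t ht).1, fun t ht ↦ (main t ht).2.continuousWithinAt⟩

/-- The character `x ↦ e^{2πix}` of `ℝ`. -/
noncomputable def unitExp (x : ℝ) : ℂ := Complex.exp (2 * (π : ℂ) * Complex.I * (x : ℂ))

theorem norm_unitExp (x : ℝ) : ‖unitExp x‖ = 1 := by
  rw [unitExp, show 2 * (π : ℂ) * Complex.I * (x : ℂ) = ((2 * π * x : ℝ) : ℂ) * Complex.I by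
    push_cast; ring]
  exact Complex.norm_exp_ofReal_mul_I _

@[fun_prop]
theorem continuous_unitExp : Continuous unitExp := by
  unfold unitExp; fun_prop

theorem unitExp_add (x y : ℝ) : unitExp (x + y) = unitExp x * unitExp y := by
  rw [unitExp, unitExp, unitExp, ← Complex.exp_add]; push_cast; ring_nf

theorem hasDerivAt_unitExp (x : ℝ) :
    HasDerivAt unitExp (2 * (π : ℂ) * Complex.I * unitExp x) x := by
  have h1 : HasDerivAt (fun x : ℝ ↦ 2 * (π : ℂ) * Complex.I * (x : ℂ))
      (2 * (π : ℂ) * Complex.I * 1) x := (HasDerivAt.ofReal_comp (hasDerivAt_id x)).const_mul _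
  convert! h1.cexp using 1
  rw [unitExp]; ring

open scoped FourierTransform in
theorem fourier_eq_integral_unitExp (f : ℝ → ℂ) (ξ : ℝ) :
    𝓕 f ξ = ∫ x, unitExp (-(x * ξ)) * f x := by
  rw [Real.fourier_real_eq_integral_exp_smul]
  refine integral_congr_ae (.of_forall fun x ↦ ?_)
  simp only [unitExp, smul_eq_mul]
  push_cast
  ring_nf

/-- Plancherel's theorem for continuous functions vanishing off a compact interval. -/
theorem lintegral_enorm_sq_integral_unitExp {k : ℝ → ℂ} (hk : Continuous k) {L : ℝ}
    (h0 : ∀ x ∉ Set.Icc (-L) L, k x = 0) :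
    ∫⁻ r, ‖∫ x, unitExp (x * r) * k x‖ₑ ^ 2 = ∫⁻ x, ‖k x‖ₑ ^ 2 := by
  have hs : HasCompactSupport k := HasCompactSupport.intro isCompact_Icc h0
  rw [← lintegral_enorm_sq_fourier (hk.integrable_of_hasCompactSupport hs)
    (hk.memLp_of_hasCompactSupport hs), ← lintegral_neg_eq_self]
  simp only [fourier_eq_integral_unitExp, mul_neg]

/-- Symbols of order `1/2` on `ℝ`, with constant `B` and frequencies at most `X`. -/
structure IsHalfSymbol (β : ℝ → ℂ) (B X : ℝ) : Prop where
  contDiff : ContDiff ℝ 1 β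
  eq_zero : ∀ σ ∉ Set.Icc (-X) X, β σ = 0
  bound : ∀ σ, ‖β σ‖ ^ 2 ≤ B ^ 2 * |σ|
  bound_deriv : ∀ σ, ‖σ * deriv β σ‖ ^ 2 ≤ B ^ 2 * |σ|

namespace IsHalfSymbol

variable {β : ℝ → ℂ} {B X : ℝ}

theorem continuous (hβ : IsHalfSymbol β B X) : Continuous β := hβ.contDiff.continuous

theorem continuous_deriv (hβ : IsHalfSymbol β B X) : Continuous (deriv β) :=
  hβ.contDiff.continuous_deriv le_rfl

theorem deriv_eq_zero (hβ : IsHalfSymbol β B X) {σ : ℝ} (hσ : σ ∉ Set.Icc (-X) X) :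
    deriv β σ = 0 := by
  have : β =ᶠ[nhds σ] fun _ ↦ 0 := by
    filter_upwards [isClosed_Icc.isOpen_compl.mem_nhds hσ] with s hs using hβ.eq_zero s hs
  rw [this.deriv_eq, deriv_const]

theorem div_notMem {R t ρ : ℝ} (ht : 0 < t) (htR : t ≤ R)
    (hρ : ρ ∉ Set.Icc (-(R * X)) (R * X)) (hX : 0 ≤ X) : ρ / t ∉ Set.Icc (-X) X := by
  contrapose! hρ
  rw [Set.mem_Icc, le_div_iff₀ ht, div_le_iff₀ ht] at hρ
  have := mul_le_mul_of_nonneg_left htR hX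
  exact ⟨by nlinarith [hρ.1], by nlinarith [hρ.2]⟩

/-- The one-dimensional radial estimate. -/
theorem radial_estimate (hβ : IsHalfSymbol β B X) (hX : 0 ≤ X) {R : ℝ} (hR : 0 < R) {g : ℝ → ℂ}
    (hg : Continuous g) :
    ENNReal.ofReal R * ∫⁻ r in Set.Icc R (3 * R),
        ‖∫ ρ, unitExp (ρ * r) * (β (ρ / r) * g ρ)‖ₑ ^ 2 ≤
      20 * ENNReal.ofReal (B ^ 2) * ∫⁻ ρ in Set.Icc (-(3 * R * X)) (3 * R * X),
        ENNReal.ofReal |ρ| * ‖g ρ‖ₑ ^ 2 := by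
  set N := ∫⁻ ρ in Set.Icc (-(3 * R * X)) (3 * R * X), ENNReal.ofReal |ρ| * ‖g ρ‖ₑ ^ 2 with hN
  set J := Set.Icc R (3 * R) with hJ
  set U := Set.Ioo (R / 2) (4 * R) with hU
  let k : ℝ → ℝ → ℂ := fun t ρ ↦ β (ρ / t) * g ρ
  let k' : ℝ → ℝ → ℂ := fun t ρ ↦ -(ρ / t ^ 2 : ℝ) * deriv β (ρ / t) * g ρ
  have hβc := hβ.continuous
  have hβc' := hβ.continuous_deriv
  have hpos : ∀ t ∈ U, 0 < t := fun t ht ↦ by linarith [ht.1]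
  have hJU : J ⊆ U := fun t ht ↦ ⟨by linarith [ht.1], by linarith [ht.2]⟩
  have hk0 : ∀ S, ∀ t ∈ U, t ≤ S → ∀ ρ ∉ Set.Icc (-(S * X)) (S * X), k t ρ = 0 := by
    intro S t ht htS ρ hρ
    simp [k, hβ.eq_zero _ (div_notMem (hpos t ht) htS hρ hX)]
  have hk0' : ∀ S, ∀ t ∈ U, t ≤ S → ∀ ρ ∉ Set.Icc (-(S * X)) (S * X), k' t ρ = 0 := by
    intro S t ht htS ρ hρ
    simp [k', hβ.deriv_eq_zero (div_notMem (hpos t ht) htS hρ hX)]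
  have hkm : Measurable (Function.uncurry k) := by
    have := hβc.measurable
    have := hg.measurable
    simp only [k, Function.uncurry_def]
    fun_prop
  have hkm' : Measurable (Function.uncurry k') := by
    have := hβc'.measurable
    have := hg.measurable
    simp only [k', Function.uncurry_def]
    fun_prop
  have hdiv : ContinuousOn (fun p : ℝ × ℝ ↦ p.2 / p.1) (U ×ˢ Set.univ) :=
    continuousOn_snd.div continuousOn_fst fun p hp ↦ (hpos p.1 hp.1).ne'
  have hkc : ContinuousOn (Function.uncurry k) (U ×ˢ Set.univ) :=
    (hβc.comp_continuousOn hdiv).mul (hg.comp_continuousOn continuousOn_snd)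
  have hkc' : ContinuousOn (Function.uncurry k') (U ×ˢ Set.univ) := by
    refine ((ContinuousOn.neg ?_).mul (hβc'.comp_continuousOn hdiv)).mul
      (hg.comp_continuousOn continuousOn_snd)
    refine Complex.continuous_ofReal.comp_continuousOn ?_
    exact continuousOn_snd.div (continuousOn_fst.pow 2) fun p hp ↦ (pow_pos (hpos p.1 hp.1) 2).ne'
  have hkd : ∀ t ∈ U, ∀ ρ, HasDerivAt (fun s ↦ k s ρ) (k' t ρ) t := by
    intro t ht ρ
    have h1 : HasDerivAt (fun s : ℝ ↦ ρ / s) (-(ρ / t ^ 2)) t := by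
      have := (hasDerivAt_inv (hpos t ht).ne').const_mul ρ
      convert! this using 1
      ring
    have h2 : HasDerivAt β (deriv β (ρ / t)) (ρ / t) :=
      ((hβ.contDiff.differentiable one_ne_zero) _).hasDerivAt
    have h3 := (h2.scomp t h1).mul_const (g ρ)
    convert! h3 using 1
    simp [k']
  have hslice : ∀ (φ : ℝ → ℝ → ℂ), ContinuousOn (Function.uncurry φ) (U ×ˢ Set.univ) →
      ∀ t ∈ U, Continuous (φ t) := by
    intro φ hφ t ht
    rw [← continuousOn_univ]
    exact hφ.comp (f := fun x : ℝ ↦ (t, x)) (by fun_prop) (fun x _ ↦ ⟨ht, trivial⟩)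
  -- the point bound in the dilation parameter
  have hpt : ∀ r ∈ J, ENNReal.ofReal R * ‖∫ ρ, unitExp (ρ * r) * k r ρ‖ₑ ^ 2 ≤
      2 * (∫⁻ t in J, ‖∫ ρ, unitExp (ρ * r) * k t ρ‖ₑ ^ 2) + 2 * ENNReal.ofReal (2 * R) ^ 2 *
        ∫⁻ t in J, ‖∫ ρ, unitExp (ρ * r) * k' t ρ‖ₑ ^ 2 := by
    intro r hr
    have hec : ContinuousOn (fun p : ℝ × ℝ ↦ unitExp (p.2 * r)) (U ×ˢ Set.univ) := by fun_prop
    obtain ⟨hd, hcd⟩ := hasDerivAt_integral_of_continuousOn (U := U) isOpen_Ioo (L := 4 * R * X)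
      (ψ := fun t ρ ↦ unitExp (ρ * r) * k t ρ) (ψ' := fun t ρ ↦ unitExp (ρ * r) * k' t ρ)
      (fun t ht ρ hρ ↦ by simp only [hk0 (4 * R) t ht ht.2.le ρ hρ, mul_zero])
      (fun t ht ρ hρ ↦ by simp only [hk0' (4 * R) t ht ht.2.le ρ hρ, mul_zero])
      (hec.mul hkc) (hec.mul hkc') (fun t ht ρ ↦ (hkd t ht ρ).const_mul _)
    have hJ' : Set.Icc R (R + 2 * R) = J := by rw [hJ]; congr 1; ring
    have := enorm_sq_le_lintegral_add_deriv (a := R) (l := 2 * R)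
      (fun t ht ↦ hd t (hJU (hJ' ▸ ht))) (by rw [hJ']; exact hcd.mono hJU) (hJ' ▸ hr)
    rw [hJ'] at this
    refine le_trans ?_ this
    gcongr
    linarith
  have hmeas : ∀ φ : ℝ → ℝ → ℂ, Measurable (Function.uncurry φ) →
      Measurable (fun p : ℝ × ℝ ↦ ‖∫ ρ, unitExp (ρ * p.1) * φ p.2 ρ‖ₑ ^ 2) := by
    intro φ hφ
    have hm : Measurable (fun q : (ℝ × ℝ) × ℝ ↦ unitExp (q.2 * q.1.1) * φ q.1.2 q.2) := by
      refine Measurable.mul ?_ (hφ.comp (f := fun q : (ℝ × ℝ) × ℝ ↦ (q.1.2, q.2)) (by fun_prop))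
      exact continuous_unitExp.measurable.comp (by fun_prop)
    exact (hm.stronglyMeasurable.integral_prod_right').measurable.enorm.pow_const 2
  -- Plancherel in the radial variable
  have hplan : ∀ φ : ℝ → ℝ → ℂ, Measurable (Function.uncurry φ) → (∀ t ∈ J, Continuous (φ t)) →
      ∀ D : ℝ, 0 ≤ D → (∀ t ∈ J, ∀ ρ ∉ Set.Icc (-(3 * R * X)) (3 * R * X), φ t ρ = 0) →
      (∀ t ∈ J, ∀ ρ, ‖φ t ρ‖ ^ 2 ≤ D * (|ρ| * ‖g ρ‖ ^ 2)) →
      ∫⁻ r in J, ∫⁻ t in J, ‖∫ ρ, unitExp (ρ * r) * φ t ρ‖ₑ ^ 2 ≤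
        ENNReal.ofReal (2 * R) * (ENNReal.ofReal D * N) := by
    intro φ hφ hφc D hD hφ0 hφb
    rw [lintegral_lintegral_swap (hmeas φ hφ).aemeasurable]
    calc ∫⁻ t in J, ∫⁻ r in J, ‖∫ ρ, unitExp (ρ * r) * φ t ρ‖ₑ ^ 2
        ≤ ∫⁻ _ in J, ENNReal.ofReal D * N := by
          refine setLIntegral_mono' measurableSet_Icc fun t ht ↦ ?_
          refine (setLIntegral_le_lintegral _ _).trans ?_
          rw [lintegral_enorm_sq_integral_unitExp (hφc t ht) (hφ0 t ht), hN,
            ← lintegral_const_mul' _ _ ENNReal.ofReal_ne_top,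
            ← lintegral_indicator measurableSet_Icc]
          refine lintegral_mono fun ρ ↦ ?_
          by_cases hρ : ρ ∈ Set.Icc (-(3 * R * X)) (3 * R * X)
          · rw [Set.indicator_of_mem hρ, ← ofReal_norm, ← ofReal_norm,
              ← ENNReal.ofReal_pow (norm_nonneg _), ← ENNReal.ofReal_pow (norm_nonneg _),
              ← ENNReal.ofReal_mul (abs_nonneg _), ← ENNReal.ofReal_mul hD]
            exact ENNReal.ofReal_le_ofReal (hφb t ht ρ)
          · simp [hφ0 t ht ρ hρ]
      _ = _ := by
          rw [lintegral_const, Measure.restrict_apply_univ, hJ, Real.volume_Icc, mul_comm]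
          congr 2; ring
  have hb1 := hplan k hkm (fun t ht ↦ hslice k hkc t (hJU ht)) (B ^ 2 / R) (by positivity)
    (fun t ht ↦ hk0 (3 * R) t (hJU ht) ht.2) (by
      intro t ht ρ
      have ht0 := hpos t (hJU ht)
      have h1 := hβ.bound (ρ / t)
      rw [abs_div, abs_of_pos ht0] at h1
      have h2 : |ρ| / t ≤ |ρ| / R := by gcongr; exact ht.1
      simp only [k, norm_mul, mul_pow]
      calc ‖β (ρ / t)‖ ^ 2 * ‖g ρ‖ ^ 2 ≤ (B ^ 2 * (|ρ| / R)) * ‖g ρ‖ ^ 2 := by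
            gcongr; exact h1.trans (by gcongr)
        _ = _ := by ring)
  have hb2 := hplan k' hkm' (fun t ht ↦ hslice k' hkc' t (hJU ht)) (B ^ 2 / R ^ 3) (by positivity)
    (fun t ht ↦ hk0' (3 * R) t (hJU ht) ht.2) (by
      intro t ht ρ
      have ht0 := hpos t (hJU ht)
      have h1 := hβ.bound_deriv (ρ / t)
      rw [abs_div, abs_of_pos ht0] at h1
      have h2 : |ρ| / t ≤ |ρ| / R := by gcongr; exact ht.1
      have h3 : k' t ρ = -(t⁻¹ : ℝ) * ((ρ / t : ℝ) * deriv β (ρ / t)) * g ρ := by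
        simp only [k']; push_cast; ring
      have h4 : t⁻¹ ≤ R⁻¹ := by gcongr; exact ht.1
      rw [h3, norm_mul, norm_mul, norm_neg, Complex.norm_real, Real.norm_of_nonneg (by positivity),
        mul_pow, mul_pow]
      calc t⁻¹ ^ 2 * ‖((ρ / t : ℝ) : ℂ) * deriv β (ρ / t)‖ ^ 2 * ‖g ρ‖ ^ 2
          ≤ R⁻¹ ^ 2 * (B ^ 2 * (|ρ| / R)) * ‖g ρ‖ ^ 2 := by
            gcongr; exact h1.trans (by gcongr)
        _ = _ := by field_simp)
  calc ENNReal.ofReal R * ∫⁻ r in J, ‖∫ ρ, unitExp (ρ * r) * k r ρ‖ₑ ^ 2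
      = ∫⁻ r in J, ENNReal.ofReal R * ‖∫ ρ, unitExp (ρ * r) * k r ρ‖ₑ ^ 2 :=
        (lintegral_const_mul' _ _ ENNReal.ofReal_ne_top).symm
    _ ≤ ∫⁻ r in J, (2 * (∫⁻ t in J, ‖∫ ρ, unitExp (ρ * r) * k t ρ‖ₑ ^ 2) +
          2 * ENNReal.ofReal (2 * R) ^ 2 * ∫⁻ t in J, ‖∫ ρ, unitExp (ρ * r) * k' t ρ‖ₑ ^ 2) :=
        setLIntegral_mono' measurableSet_Icc hpt
    _ = 2 * (∫⁻ r in J, ∫⁻ t in J, ‖∫ ρ, unitExp (ρ * r) * k t ρ‖ₑ ^ 2) +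
          2 * ENNReal.ofReal (2 * R) ^ 2 *
            ∫⁻ r in J, ∫⁻ t in J, ‖∫ ρ, unitExp (ρ * r) * k' t ρ‖ₑ ^ 2 := by
        rw [lintegral_add_left, lintegral_const_mul' _ _ (by simp),
          lintegral_const_mul' _ _ (by finiteness)]
        exact (Measurable.lintegral_prod_right' (hmeas k hkm)).const_mul 2
    _ ≤ 2 * (ENNReal.ofReal (2 * R) * (ENNReal.ofReal (B ^ 2 / R) * N)) +
          2 * ENNReal.ofReal (2 * R) ^ 2 *
            (ENNReal.ofReal (2 * R) * (ENNReal.ofReal (B ^ 2 / R ^ 3) * N)) := by gcongr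
    _ = (ENNReal.ofReal (2 * (2 * R * (B ^ 2 / R))) +
          ENNReal.ofReal (2 * (2 * R) ^ 2 * (2 * R * (B ^ 2 / R ^ 3)))) * N := by
        have e1 : ENNReal.ofReal (2 * (2 * R * (B ^ 2 / R))) =
            2 * (ENNReal.ofReal (2 * R) * ENNReal.ofReal (B ^ 2 / R)) := by
          rw [ENNReal.ofReal_mul zero_le_two, ENNReal.ofReal_mul (p := 2 * R) (by positivity),
            ENNReal.ofReal_ofNat]
        have e2 : ENNReal.ofReal (2 * (2 * R) ^ 2 * (2 * R * (B ^ 2 / R ^ 3))) =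
            2 * ENNReal.ofReal (2 * R) ^ 2 *
              (ENNReal.ofReal (2 * R) * ENNReal.ofReal (B ^ 2 / R ^ 3)) := by
          rw [ENNReal.ofReal_mul (p := 2 * (2 * R) ^ 2) (by positivity),
            ENNReal.ofReal_mul zero_le_two, ENNReal.ofReal_mul (p := 2 * R) (by positivity),
            ENNReal.ofReal_pow (by positivity), ENNReal.ofReal_ofNat]
        rw [e1, e2]
        ring
    _ = 20 * ENNReal.ofReal (B ^ 2) * N := by
        rw [← ENNReal.ofReal_add (by positivity) (by positivity)]
        congr 1
        rw [show (20 : ℝ≥0∞) = ENNReal.ofReal 20 by simp, ← ENNReal.ofReal_mul (by norm_num)]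
        congr 1
        field_simp
        ring

end IsHalfSymbol

/-- The superposition of the values of `F` along the line spanned by `y`, with amplitude `β` and
quadratic phase. -/
noncomputable def rayIntegral (β : ℝ → ℂ) (F : ℝ × ℝ → ℂ) (y : ℝ × ℝ) : ℂ :=
  ∫ σ, unitExp (σ * (y.1 ^ 2 + y.2 ^ 2)) * (β σ * F (σ * y.1, σ * y.2))

/-- The planar annulus of radii `R` and `3R`. -/
def planarAnnulus (R : ℝ) : Set (ℝ × ℝ) :=
  {y | R ^ 2 ≤ y.1 ^ 2 + y.2 ^ 2 ∧ y.1 ^ 2 + y.2 ^ 2 ≤ (3 * R) ^ 2}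

theorem measurableSet_planarAnnulus (R : ℝ) : MeasurableSet (planarAnnulus R) := by
  have h : Measurable fun y : ℝ × ℝ ↦ y.1 ^ 2 + y.2 ^ 2 := by fun_prop
  exact (measurableSet_le measurable_const h).inter (measurableSet_le h measurable_const)

theorem measurable_rayIntegral {β : ℝ → ℂ} {F : ℝ × ℝ → ℂ} (hβ : Continuous β)
    (hF : Continuous F) : Measurable (rayIntegral β F) := by
  have h : Continuous (fun q : (ℝ × ℝ) × ℝ ↦ unitExp (q.2 * (q.1.1 ^ 2 + q.1.2 ^ 2)) *
      (β q.2 * F (q.2 * q.1.1, q.2 * q.1.2))) := by fun_prop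
  exact h.stronglyMeasurable.integral_prod_right'.measurable

theorem rayIntegral_polar (β : ℝ → ℂ) (F : ℝ × ℝ → ℂ) {r : ℝ} (hr : 0 < r) (θ : ℝ) :
    (r : ℂ) * rayIntegral β F (r * cos θ, r * sin θ) =
      ∫ ρ, unitExp (ρ * r) * (β (ρ / r) * F (ρ * cos θ, ρ * sin θ)) := by
  have h := Measure.integral_comp_mul_right
    (fun ρ ↦ unitExp (ρ * r) * (β (ρ / r) * F (ρ * cos θ, ρ * sin θ))) r
  rw [abs_of_pos (inv_pos.2 hr)] at h
  have h2 : rayIntegral β F (r * cos θ, r * sin θ) =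
      ∫ σ, unitExp (σ * r * r) * (β (σ * r / r) * F (σ * r * cos θ, σ * r * sin θ)) := by
    unfold rayIntegral
    refine integral_congr_ae (.of_forall fun σ ↦ ?_)
    have e : σ * ((r * cos θ) ^ 2 + (r * sin θ) ^ 2) = σ * r * r := by
      linear_combination σ * r ^ 2 * Real.sin_sq_add_cos_sq θ
    simp only [e, mul_assoc, mul_div_cancel_right₀ _ hr.ne']
  rw [h2, h, Complex.real_smul, ← mul_assoc, ← Complex.ofReal_mul, mul_inv_cancel₀ hr.ne',
    Complex.ofReal_one, one_mul]

theorem lintegral_abs_mul_eq (f : ℝ → ℝ≥0∞) (hf : Measurable f) :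
    ∫⁻ ρ, ENNReal.ofReal |ρ| * f ρ = ∫⁻ ρ in Set.Ioi 0, ENNReal.ofReal ρ * (f ρ + f (-ρ)) := by
  have h1 : ∀ ρ : ℝ, ENNReal.ofReal |ρ| = ENNReal.ofReal ρ + ENNReal.ofReal (-ρ) := by
    intro ρ
    rcases le_total 0 ρ with h | h
    · rw [abs_of_nonneg h, ENNReal.ofReal_of_nonpos (neg_nonpos.2 h), add_zero]
    · rw [abs_of_nonpos h, ENNReal.ofReal_of_nonpos h, zero_add]
  have h2 : ∫⁻ ρ, ENNReal.ofReal (-ρ) * f ρ = ∫⁻ ρ, ENNReal.ofReal ρ * f (-ρ) := by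
    rw [← lintegral_neg_eq_self]
    simp only [neg_neg]
  simp only [h1, add_mul]
  rw [lintegral_add_left (by fun_prop), h2, ← lintegral_add_left (by fun_prop),
    ← lintegral_indicator measurableSet_Ioi]
  refine lintegral_congr fun ρ ↦ ?_
  by_cases h : ρ ∈ Set.Ioi (0 : ℝ)
  · rw [Set.indicator_of_mem h, mul_add]
  · rw [Set.indicator_of_notMem h, ENNReal.ofReal_of_nonpos (not_lt.1 h), zero_mul, zero_mul,
      add_zero]

theorem lintegral_eq_polar {f : ℝ × ℝ → ℝ≥0∞} (hf : Measurable f) :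
    ∫⁻ y, f y = ∫⁻ θ in Set.Ioo (-π) π, ∫⁻ r in Set.Ioi (0 : ℝ),
      ENNReal.ofReal r * f (r * cos θ, r * sin θ) := by
  rw [← lintegral_comp_polarCoord_symm, polarCoord_target, Measure.volume_eq_prod,
    ← Measure.prod_restrict, lintegral_prod_symm]
  · simp [polarCoord_symm_apply]
  · have : Measurable (fun p : ℝ × ℝ ↦ ENNReal.ofReal p.1 • f (p.1 * cos p.2, p.1 * sin p.2)) := by
      simp only [smul_eq_mul]
      fun_prop
    exact this.aemeasurable

/-- The `L²` estimate for `rayIntegral` on an annulus. -/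
theorem IsHalfSymbol.annulus_estimate {β : ℝ → ℂ} {B X : ℝ} (hβ : IsHalfSymbol β B X)
    (hX : 0 ≤ X) {R : ℝ} (hR : 0 < R) {F : ℝ × ℝ → ℂ} (hF : Continuous F) :
    ENNReal.ofReal (R ^ 2) * ∫⁻ y in planarAnnulus R, ‖rayIntegral β F y‖ₑ ^ 2 ≤
      40 * ENNReal.ofReal (B ^ 2) *
        ∫⁻ ξ in Set.univ ×ˢ Set.Icc (-(3 * R * X)) (3 * R * X), ‖F ξ‖ₑ ^ 2 := by
  set L := 3 * R * X with hL
  have hL0 : 0 ≤ L := by positivity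
  set S : Set (ℝ × ℝ) := Set.univ ×ˢ Set.Icc (-L) L with hS
  have hSm : MeasurableSet S := MeasurableSet.univ.prod measurableSet_Icc
  set H : ℝ × ℝ → ℝ≥0∞ := S.indicator (fun ξ ↦ ‖F ξ‖ₑ ^ 2) with hH
  have hHm : Measurable H := (hF.measurable.enorm.pow_const 2).indicator hSm
  have hPm : Measurable ((planarAnnulus R).indicator fun y ↦ ‖rayIntegral β F y‖ₑ ^ 2) :=
    ((measurable_rayIntegral hβ.continuous hF).enorm.pow_const 2).indicator
      (measurableSet_planarAnnulus R)
  have hray : ∀ θ : ℝ, ENNReal.ofReal (R ^ 2) * ∫⁻ r in Set.Ioi (0 : ℝ), ENNReal.ofReal r *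
      (planarAnnulus R).indicator (fun y ↦ ‖rayIntegral β F y‖ₑ ^ 2) (r * cos θ, r * sin θ) ≤
      20 * ENNReal.ofReal (B ^ 2) * ∫⁻ r in Set.Ioi (0 : ℝ), ENNReal.ofReal r *
        (H (r * cos θ, r * sin θ) + H (-(r * cos θ, r * sin θ))) := by
    intro θ
    have hg : Continuous fun ρ : ℝ ↦ F (ρ * cos θ, ρ * sin θ) := by fun_prop
    have hrad := hβ.radial_estimate hX hR hg
    have h1 : ENNReal.ofReal (R ^ 2) * ∫⁻ r in Set.Ioi (0 : ℝ), ENNReal.ofReal r *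
        (planarAnnulus R).indicator (fun y ↦ ‖rayIntegral β F y‖ₑ ^ 2) (r * cos θ, r * sin θ) ≤
        ENNReal.ofReal R * ∫⁻ r in Set.Icc R (3 * R),
          ‖∫ ρ, unitExp (ρ * r) * (β (ρ / r) * F (ρ * cos θ, ρ * sin θ))‖ₑ ^ 2 := by
      rw [← lintegral_const_mul' _ _ ENNReal.ofReal_ne_top,
        ← lintegral_const_mul' _ _ ENNReal.ofReal_ne_top, ← lintegral_indicator measurableSet_Ioi,
        ← lintegral_indicator measurableSet_Icc]
      refine lintegral_mono fun r ↦ ?_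
      by_cases hr : r ∈ Set.Ioi (0 : ℝ)
      swap
      · rw [Set.indicator_of_notMem hr]
        exact zero_le
      rw [Set.indicator_of_mem hr]
      have hr0 : 0 < r := hr
      by_cases hA : (r * cos θ, r * sin θ) ∈ planarAnnulus R
      swap
      · rw [Set.indicator_of_notMem hA, mul_zero, mul_zero]
        exact zero_le
      have hsq : (r * cos θ) ^ 2 + (r * sin θ) ^ 2 = r ^ 2 := by
        linear_combination r ^ 2 * Real.sin_sq_add_cos_sq θ
      have hrJ : r ∈ Set.Icc R (3 * R) := by
        obtain ⟨h1, h2⟩ := hA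
        simp only [hsq] at h1 h2
        exact ⟨by nlinarith, by nlinarith⟩
      rw [Set.indicator_of_mem hA, Set.indicator_of_mem hrJ, ← rayIntegral_polar β F hr0 θ,
        enorm_mul, mul_pow, ← mul_assoc, ← mul_assoc]
      refine mul_le_mul' ?_ le_rfl
      rw [← ofReal_norm, Complex.norm_real, Real.norm_of_nonneg hr0.le,
        ← ENNReal.ofReal_pow hr0.le, ← ENNReal.ofReal_mul (by positivity),
        ← ENNReal.ofReal_mul hR.le]
      refine ENNReal.ofReal_le_ofReal ?_
      have : R * r * R ≤ R * r * r := by gcongr; exact hrJ.1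
      nlinarith
    refine h1.trans (hrad.trans (mul_le_mul' le_rfl ?_))
    have h2 := lintegral_abs_mul_eq (fun ρ ↦ H (ρ * cos θ, ρ * sin θ))
      (hHm.comp (by fun_prop))
    simp only [neg_mul] at h2
    simp only [Prod.neg_mk]
    rw [← h2, ← lintegral_indicator measurableSet_Icc]
    refine lintegral_mono fun ρ ↦ ?_
    by_cases hρ : ρ ∈ Set.Icc (-L) L
    · have hmem : (ρ * cos θ, ρ * sin θ) ∈ S := by
        refine ⟨trivial, ?_⟩
        refine abs_le.1 ?_
        have hρ' : |ρ| ≤ L := abs_le.2 hρ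
        rw [abs_mul]
        nlinarith [Real.abs_sin_le_one θ, abs_nonneg ρ]
      rw [Set.indicator_of_mem hρ, hH, Set.indicator_of_mem hmem]
    · rw [Set.indicator_of_notMem hρ]
      exact zero_le
  calc ENNReal.ofReal (R ^ 2) * ∫⁻ y in planarAnnulus R, ‖rayIntegral β F y‖ₑ ^ 2
      = ∫⁻ θ in Set.Ioo (-π) π, ENNReal.ofReal (R ^ 2) * ∫⁻ r in Set.Ioi (0 : ℝ),
          ENNReal.ofReal r * (planarAnnulus R).indicator (fun y ↦ ‖rayIntegral β F y‖ₑ ^ 2)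
            (r * cos θ, r * sin θ) := by
        rw [← lintegral_indicator (measurableSet_planarAnnulus R), lintegral_eq_polar hPm,
          lintegral_const_mul' _ _ ENNReal.ofReal_ne_top]
    _ ≤ ∫⁻ θ in Set.Ioo (-π) π, 20 * ENNReal.ofReal (B ^ 2) * ∫⁻ r in Set.Ioi (0 : ℝ),
          ENNReal.ofReal r * (H (r * cos θ, r * sin θ) + H (-(r * cos θ, r * sin θ))) :=
        lintegral_mono hray
    _ = 20 * ENNReal.ofReal (B ^ 2) * ∫⁻ y, (H y + H (-y)) := by
        rw [lintegral_const_mul' _ _ (by finiteness),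
          lintegral_eq_polar (f := fun y ↦ H y + H (-y)) (by fun_prop)]
    _ = 20 * ENNReal.ofReal (B ^ 2) * (2 * ∫⁻ y, H y) := by
        rw [lintegral_add_left hHm, lintegral_neg_eq_self H, two_mul]
    _ = _ := by
        rw [hH, lintegral_indicator hSm]
        ring

theorem conj_unitExp (x : ℝ) : (starRingEnd ℂ) (unitExp x) = unitExp (-x) := by
  rw [unitExp, unitExp, ← Complex.exp_conj]
  simp [Complex.conj_ofNat]

theorem unitExp_intCast (n : ℤ) : unitExp n = 1 := by
  rw [unitExp, ← Complex.exp_int_mul_two_pi_mul_I n]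
  congr 1
  push_cast
  ring

theorem intervalIntegral_unitExp_int_mul (j : ℤ) (N : ℕ) :
    ∫ t in (-N : ℝ)..N, unitExp (j * t) = if j = 0 then 2 * (N : ℂ) else 0 := by
  split_ifs with h
  · subst h
    simp [unitExp]
    ring
  · have h2 : (2 * (π : ℂ) * Complex.I * j) ≠ 0 := by
      simp [h, Real.pi_ne_zero]
    have h3 := integral_exp_mul_complex (a := -N) (b := N) h2
    have h4 : ∀ t : ℝ, unitExp (j * t) = Complex.exp (2 * (π : ℂ) * Complex.I * j * t) := by
      intro t
      rw [unitExp]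
      congr 1
      push_cast
      ring
    rw [← h4, ← h4] at h3
    simp only [h4] at h3 ⊢
    rw [h3, ← h4, ← h4]
    have e1 : unitExp (j * (N : ℝ)) = 1 := by
      rw [show (j * (N : ℝ) : ℝ) = ((j * N : ℤ) : ℝ) by push_cast; ring, unitExp_intCast]
    have e2 : unitExp (j * (-N : ℝ)) = 1 := by
      rw [show (j * (-N : ℝ) : ℝ) = ((-(j * N) : ℤ) : ℝ) by push_cast; ring, unitExp_intCast]
    rw [e1, e2, sub_self, zero_div]

/-- Orthogonality of characters over a symmetric interval of integer radius. -/
theorem setLIntegral_enorm_sq_sum_unitExp (S : Finset ℤ) (c : ℤ → ℂ) (N : ℕ) :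
    ∫⁻ t in Set.Icc (-N : ℝ) N, ‖∑ k ∈ S, unitExp (-(k * t)) * c k‖ₑ ^ 2 =
      2 * N * ∑ k ∈ S, ‖c k‖ₑ ^ 2 := by
  have hc : Continuous fun t : ℝ ↦ ∑ k ∈ S, unitExp (-(k * t)) * c k := by fun_prop
  have key : ∫ t in (-N : ℝ)..N, ‖∑ k ∈ S, unitExp (-(k * t)) * c k‖ ^ 2 =
      2 * N * ∑ k ∈ S, ‖c k‖ ^ 2 := by
    have h1 : ((∫ t in (-N : ℝ)..N, ‖∑ k ∈ S, unitExp (-(k * t)) * c k‖ ^ 2 : ℝ) : ℂ) =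
        ((2 * N * ∑ k ∈ S, ‖c k‖ ^ 2 : ℝ) : ℂ) := by
      rw [← intervalIntegral.integral_ofReal]
      have h2 : ∀ t : ℝ, ((‖∑ k ∈ S, unitExp (-(k * t)) * c k‖ ^ 2 : ℝ) : ℂ) =
          ∑ k ∈ S, ∑ l ∈ S, c k * (starRingEnd ℂ) (c l) * unitExp ((l - k : ℤ) * t) := by
        intro t
        push_cast
        rw [← Complex.mul_conj', map_sum, Finset.sum_mul_sum]
        refine Finset.sum_congr rfl fun k _ ↦ Finset.sum_congr rfl fun l _ ↦ ?_
        rw [map_mul, conj_unitExp, neg_neg, show (l - k : ℝ) * t = -(k * t) + l * t by ring,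
          unitExp_add]
        ring
      simp only [h2]
      rw [intervalIntegral.integral_finsetSum]
      swap
      · intro k _
        exact Continuous.intervalIntegrable (by fun_prop) _ _
      rw [Complex.ofReal_mul, Complex.ofReal_sum, Finset.mul_sum]
      refine Finset.sum_congr rfl fun k hk ↦ ?_
      rw [intervalIntegral.integral_finsetSum]
      swap
      · intro l _
        exact Continuous.intervalIntegrable (by fun_prop) _ _
      rw [Finset.sum_eq_single_of_mem k hk]
      · have := intervalIntegral_unitExp_int_mul (k - k) N
        rw [if_pos (sub_self k)] at this
        rw [intervalIntegral.integral_const_mul, this, Complex.ofReal_pow, ← Complex.mul_conj']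
        push_cast
        ring
      · intro l _ hl
        rw [intervalIntegral.integral_const_mul, intervalIntegral_unitExp_int_mul,
          if_neg (sub_ne_zero.2 hl), mul_zero]
    exact_mod_cast h1
  have e : ∀ z : ℂ, ‖z‖ₑ ^ 2 = ENNReal.ofReal (‖z‖ ^ 2) := fun z ↦ by
    rw [← ofReal_norm, ENNReal.ofReal_pow (norm_nonneg _)]
  simp only [e]
  rw [← ofReal_integral_eq_lintegral_ofReal, integral_Icc_eq_integral_Ioc,
    ← intervalIntegral.integral_of_le (by linarith [Nat.cast_nonneg (α := ℝ) N]), key,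
    ENNReal.ofReal_mul (by positivity), ENNReal.ofReal_sum_of_nonneg (fun _ _ ↦ by positivity),
    ENNReal.ofReal_mul zero_le_two, ENNReal.ofReal_natCast, ENNReal.ofReal_ofNat]
  · exact (Continuous.integrableOn_Icc (by fun_prop))
  · exact .of_forall fun t ↦ by positivity

open scoped FourierTransform in
theorem continuous_fourier_of_integrable {f : ℝ → ℂ} (hf : Integrable f) : Continuous (𝓕 f) :=
  VectorFourier.fourierIntegral_continuous Real.continuous_fourierChar continuous_inner hf

open scoped FourierTransform in
/-- The Fourier transform on `ℝ × ℤ` of a function with slices `g k`, `k ∈ S`. -/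
noncomputable def sliceFourier (S : Finset ℤ) (g : ℤ → ℝ → ℂ) (ξ : ℝ × ℝ) : ℂ :=
  ∑ k ∈ S, unitExp (-(k * ξ.2)) * 𝓕 (g k) ξ.1

theorem continuous_sliceFourier {S : Finset ℤ} {g : ℤ → ℝ → ℂ}
    (hg : ∀ k ∈ S, Integrable (g k)) : Continuous (sliceFourier S g) := by
  refine continuous_finsetSum _ fun k hk ↦ ?_
  have : Continuous (FourierTransform.fourier (g k)) := continuous_fourier_of_integrable (hg k hk)
  fun_prop

open scoped FourierTransform in
theorem setLIntegral_enorm_sq_sliceFourier {S : Finset ℤ} {g : ℤ → ℝ → ℂ}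
    (hg : ∀ k ∈ S, Integrable (g k)) (hg' : ∀ k ∈ S, MemLp (g k) 2) (N : ℕ) :
    ∫⁻ ξ in Set.univ ×ˢ Set.Icc (-N : ℝ) N, ‖sliceFourier S g ξ‖ₑ ^ 2 =
      2 * N * ∑ k ∈ S, ∫⁻ x, ‖g k x‖ₑ ^ 2 := by
  have hc := continuous_sliceFourier hg
  rw [Measure.volume_eq_prod, ← Measure.prod_restrict, Measure.restrict_univ, lintegral_prod]
  · simp only [sliceFourier, setLIntegral_enorm_sq_sum_unitExp]
    have hm : ∀ k ∈ S, Measurable (fun x ↦ ‖𝓕 (g k) x‖ₑ ^ 2) := fun k hk ↦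
      (continuous_fourier_of_integrable (hg k hk)).measurable.enorm.pow_const 2
    rw [lintegral_const_mul' _ _ (by finiteness),
      lintegral_finsetSum' _ fun k hk ↦ (hm k hk).aemeasurable]
    congr 1
    exact Finset.sum_congr rfl fun k hk ↦ lintegral_enorm_sq_fourier (hg k hk) (hg' k hk)
  · exact (hc.measurable.enorm.pow_const 2).aemeasurable

theorem IsHalfSymbol.ofReal_mul {β : ℝ → ℂ} {B X : ℝ} (hβ : IsHalfSymbol β B X) :
    IsHalfSymbol (fun σ ↦ (σ : ℂ) * β σ) (2 * X * B) X where
  contDiff := Complex.ofRealCLM.contDiff.mul hβ.contDiff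
  eq_zero σ hσ := by simp [hβ.eq_zero σ hσ]
  bound σ := by
    by_cases hσ : σ ∈ Set.Icc (-X) X
    · have h1 : |σ| ≤ X := abs_le.2 hσ
      have h2 : |σ| ^ 2 ≤ X ^ 2 := by gcongr
      rw [norm_mul, mul_pow, Complex.norm_real, Real.norm_eq_abs]
      have h3 := mul_le_mul h2 (hβ.bound σ) (by positivity) (by positivity)
      nlinarith [mul_nonneg (mul_nonneg (sq_nonneg X) (sq_nonneg B)) (abs_nonneg σ)]
    · simp only [hβ.eq_zero σ hσ, mul_zero, norm_zero]
      rw [zero_pow two_ne_zero]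
      positivity
  bound_deriv σ := by
    have hd : HasDerivAt β (deriv β σ) σ :=
      ((hβ.contDiff.differentiable one_ne_zero) σ).hasDerivAt
    have h0 : HasDerivAt (fun σ : ℝ ↦ (σ : ℂ)) 1 σ := HasDerivAt.ofReal_comp (hasDerivAt_id σ)
    rw [(h0.fun_mul hd).deriv]
    by_cases hσ : σ ∈ Set.Icc (-X) X
    · have h1 : |σ| ≤ X := abs_le.2 hσ
      have h2 : |σ| ^ 2 ≤ X ^ 2 := by gcongr
      have e : (σ : ℂ) * (1 * β σ + σ * deriv β σ) = σ * (β σ + σ * deriv β σ) := by ring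
      have h3 : ‖β σ + σ * deriv β σ‖ ^ 2 ≤ 4 * (B ^ 2 * |σ|) := by
        have h4 := norm_add_le (β σ) (σ * deriv β σ)
        have h5 := hβ.bound σ
        have h6 := hβ.bound_deriv σ
        calc ‖β σ + σ * deriv β σ‖ ^ 2 ≤ (‖β σ‖ + ‖σ * deriv β σ‖) ^ 2 := by gcongr
          _ ≤ 4 * (B ^ 2 * |σ|) := by nlinarith [sq_nonneg (‖β σ‖ - ‖σ * deriv β σ‖)]
      rw [e, norm_mul, mul_pow, Complex.norm_real, Real.norm_eq_abs]
      have h3 := mul_le_mul h2 h3 (by positivity) (by positivity)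
      nlinarith
    · simp only [hβ.eq_zero σ hσ, hβ.deriv_eq_zero hσ, mul_zero, norm_zero, add_zero]
      rw [zero_pow two_ne_zero]
      positivity

theorem hasDerivAt_sliceFourier (S : Finset ℤ) (g : ℤ → ℝ → ℂ) (x t : ℝ) :
    HasDerivAt (fun t ↦ sliceFourier S g (x, t))
      (sliceFourier S (fun k x ↦ (-(2 * π * Complex.I * k)) * g k x) (x, t)) t := by
  refine HasDerivAt.fun_sum fun k _ ↦ ?_
  have h1 : HasDerivAt (fun t : ℝ ↦ -(k * t)) (-(k * 1)) t :=
    ((hasDerivAt_id t).const_mul (k : ℝ)).neg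
  have h2 := ((hasDerivAt_unitExp (-(k * t))).scomp t h1).mul_const
    (FourierTransform.fourier (g k) x)
  convert! h2 using 1
  have : FourierTransform.fourier (fun x ↦ (-(2 * π * Complex.I * k)) * g k x) x =
      (-(2 * π * Complex.I * k)) * FourierTransform.fourier (g k) x := by
    rw [fourier_eq_integral_unitExp, fourier_eq_integral_unitExp, ← integral_const_mul]
    refine integral_congr_ae (.of_forall fun _ ↦ ?_)
    ring
  rw [this]
  simp
  ring

theorem IsHalfSymbol.continuous_rayIntegral {β : ℝ → ℂ} {B X : ℝ} (hβ : IsHalfSymbol β B X)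
    {F : ℝ × ℝ → ℂ} (hF : Continuous F) : Continuous (rayIntegral β F) := by
  have hβc := hβ.continuous
  have h := continuous_parametric_integral_of_continuous (μ := volume) (f := fun (y : ℝ × ℝ) σ ↦
    unitExp (σ * (y.1 ^ 2 + y.2 ^ 2)) * (β σ * F (σ * y.1, σ * y.2)))
    (by simp only [Function.uncurry_def]; fun_prop) (isCompact_Icc (a := -X) (b := X))
  convert! h using 2 with y
  rw [setIntegral_eq_integral_of_forall_compl_eq_zero]
  · rfl
  · intro σ hσ
    simp [hβ.eq_zero σ hσ]

/-- The derivative of `rayIntegral` in the second coordinate. -/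
theorem hasDerivAt_rayIntegral {β : ℝ → ℂ} {B X : ℝ} (hβ : IsHalfSymbol β B X)
    {F F' : ℝ × ℝ → ℂ} (hF : Continuous F) (hF' : Continuous F')
    (hd : ∀ x t, HasDerivAt (fun t ↦ F (x, t)) (F' (x, t)) t) (x t : ℝ) :
    HasDerivAt (fun t ↦ rayIntegral β F (x, t))
      (4 * π * Complex.I * t * rayIntegral (fun σ ↦ σ * β σ) F (x, t) +
        rayIntegral (fun σ ↦ σ * β σ) F' (x, t)) t := by
  have hβc := hβ.continuous
  have h1 := hasDerivAt_integral_of_continuousOn (U := Set.univ) isOpen_univ (L := X)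
    (ψ := fun t σ ↦ unitExp (σ * (x ^ 2 + t ^ 2)) * (β σ * F (σ * x, σ * t)))
    (ψ' := fun t σ ↦ 4 * π * Complex.I * t *
      (unitExp (σ * (x ^ 2 + t ^ 2)) * ((σ * β σ) * F (σ * x, σ * t))) +
      unitExp (σ * (x ^ 2 + t ^ 2)) * ((σ * β σ) * F' (σ * x, σ * t)))
    (fun t _ σ hσ ↦ by simp [hβ.eq_zero σ hσ]) (fun t _ σ hσ ↦ by simp [hβ.eq_zero σ hσ])
    (Continuous.continuousOn (by fun_prop)) (Continuous.continuousOn (by fun_prop))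
    (fun t _ σ ↦ by
      have e1 : HasDerivAt (fun t : ℝ ↦ σ * (x ^ 2 + t ^ 2)) (σ * (2 * t)) t := by
        have := ((hasDerivAt_pow 2 t).const_add (x ^ 2)).const_mul σ
        simpa using this
      have e2 := (hasDerivAt_unitExp _).scomp t e1
      have e3 : HasDerivAt (fun t : ℝ ↦ σ * t) σ t := by
        simpa using (hasDerivAt_id t).const_mul σ
      have e4 := ((hd (σ * x) (σ * t)).scomp t e3).const_mul (β σ)
      convert! e2.mul e4 using 1
      simp
      ring)
  convert! h1.1 t trivial using 1
  have hs : ∀ G : ℝ × ℝ → ℂ, Continuous G →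
      Integrable fun σ : ℝ ↦ unitExp (σ * (x ^ 2 + t ^ 2)) * ((σ * β σ) * G (σ * x, σ * t)) := by
    intro G hG
    refine Continuous.integrable_of_hasCompactSupport (by fun_prop)
      (HasCompactSupport.intro (isCompact_Icc (a := -X) (b := X)) fun σ hσ ↦ ?_)
    simp [hβ.eq_zero σ hσ]
  rw [integral_add ((hs F hF).const_mul _) (hs F' hF'), integral_const_mul]
  rfl

theorem tsum_lintegral_setLIntegral_Ioc_le {w : ℝ × ℝ → ℝ≥0∞} (hw : Measurable w) :
    ∑' n : ℤ, ∫⁻ x, ∫⁻ t in Set.Ioc (n : ℝ) (n + 1), w (x, t) ≤ ∫⁻ y, w y := by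
  have hm : ∀ n : ℤ, Measurable fun x ↦ ∫⁻ t in Set.Ioc (n : ℝ) (n + 1), w (x, t) :=
    fun n ↦ hw.lintegral_prod_right'
  rw [← lintegral_tsum fun n ↦ (hm n).aemeasurable, Measure.volume_eq_prod,
    lintegral_prod _ hw.aemeasurable]
  refine lintegral_mono fun x ↦ ?_
  rw [← lintegral_iUnion (fun _ ↦ measurableSet_Ioc) (Set.pairwise_disjoint_Ioc_intCast ℝ)]
  exact setLIntegral_le_lintegral _ _

theorem abs_snd_le_of_mem_planarAnnulus {R : ℝ} (hR : 0 < R) {y : ℝ × ℝ}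
    (hy : y ∈ planarAnnulus R) : |y.2| ≤ 3 * R := by
  refine abs_le_of_sq_le_sq ?_ (by positivity)
  nlinarith [hy.2, sq_nonneg y.1]

/-- A pointwise Sobolev bound for `rayIntegral` in the second coordinate. -/
theorem IsHalfSymbol.enorm_sq_rayIntegral_le {β : ℝ → ℂ} {B X : ℝ} (hβ : IsHalfSymbol β B X)
    {R h : ℝ} (hR : 0 < R) (h0 : 0 < h) {F F' : ℝ × ℝ → ℂ} (hF : Continuous F)
    (hF' : Continuous F') (hd : ∀ x t, HasDerivAt (fun t ↦ F (x, t)) (F' (x, t)) t) {x a : ℝ}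
    (hA : ∀ t ∈ Set.Icc a (a + h), (x, t) ∈ planarAnnulus R) :
    ENNReal.ofReal h * ‖rayIntegral β F (x, a)‖ₑ ^ 2 ≤
      ∫⁻ t in Set.Icc a (a + h), (planarAnnulus R).indicator (fun y ↦
        2 * ‖rayIntegral β F y‖ₑ ^ 2 +
        (ENNReal.ofReal (4 * h ^ 2 * (12 * π * R) ^ 2) *
          ‖rayIntegral (fun σ ↦ σ * β σ) F y‖ₑ ^ 2 +
        ENNReal.ofReal (4 * h ^ 2) * ‖rayIntegral (fun σ ↦ σ * β σ) F' y‖ₑ ^ 2)) (x, t) := by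
  have hc := hβ.continuous_rayIntegral hF
  have hc1 := hβ.ofReal_mul.continuous_rayIntegral hF
  have hc2 := hβ.ofReal_mul.continuous_rayIntegral hF'
  have h1 := enorm_sq_le_lintegral_add_deriv (a := a) (l := h)
    (fun t _ ↦ hasDerivAt_rayIntegral hβ hF hF' hd x t)
    (Continuous.continuousOn (by fun_prop)) (x := a) ⟨le_rfl, by linarith⟩
  refine h1.trans ?_
  rw [← lintegral_const_mul' _ _ (by finiteness), ← lintegral_const_mul' _ _ (by finiteness),
    ← lintegral_add_left]
  swap
  · exact ((hc.comp (by fun_prop : Continuous fun t : ℝ ↦ (x, t))).measurable.enorm.pow_const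
      2).const_mul 2
  refine setLIntegral_mono' measurableSet_Icc fun t ht ↦ ?_
  rw [Set.indicator_of_mem (hA t ht)]
  refine add_le_add le_rfl ?_
  have h2 : ‖(4 * π * Complex.I * t : ℂ)‖ₑ ≤ ENNReal.ofReal (12 * π * R) := by
    rw [← ofReal_norm]
    refine ENNReal.ofReal_le_ofReal ?_
    have := abs_snd_le_of_mem_planarAnnulus hR (hA t ht)
    simp only [norm_mul, Complex.norm_I, Complex.norm_real, Real.norm_eq_abs,
      abs_of_pos Real.pi_pos, mul_one, Complex.norm_ofNat]
    nlinarith [Real.pi_pos]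
  set P := rayIntegral (fun σ ↦ σ * β σ) F (x, t)
  set Q := rayIntegral (fun σ ↦ σ * β σ) F' (x, t)
  calc 2 * ENNReal.ofReal h ^ 2 * ‖4 * π * Complex.I * t * P + Q‖ₑ ^ 2
      ≤ 2 * ENNReal.ofReal h ^ 2 * (‖(4 * π * Complex.I * t : ℂ) * P‖ₑ + ‖Q‖ₑ) ^ 2 := by
        gcongr
        exact enorm_add_le _ _
    _ ≤ 2 * ENNReal.ofReal h ^ 2 *
          (2 * ((ENNReal.ofReal (12 * π * R) * ‖P‖ₑ) ^ 2 + ‖Q‖ₑ ^ 2)) := by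
        refine mul_le_mul' le_rfl ((ENNReal.add_sq_le_two_mul _ _).trans ?_)
        rw [enorm_mul]
        gcongr
    _ = _ := by
        rw [ENNReal.ofReal_mul (p := 4 * h ^ 2) (by positivity), ENNReal.ofReal_mul zero_le_four,
          ENNReal.ofReal_pow h0.le, ENNReal.ofReal_pow (by positivity), ENNReal.ofReal_ofNat]
        ring

/-- The discrete form of the annulus estimate. -/
theorem IsHalfSymbol.discrete_annulus_estimate {β : ℝ → ℂ} {B X : ℝ} (hβ : IsHalfSymbol β B X)
    (hX : 0 < X) {R h : ℝ} (hR : 0 < R) (h0 : 0 < h) (h1 : h ≤ 1) (hXR : h * X * R ≤ 1)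
    {S : Finset ℤ} {g : ℤ → ℝ → ℂ} (hg : ∀ k ∈ S, Integrable (g k))
    (hg' : ∀ k ∈ S, MemLp (g k) 2) (hS : ∀ k ∈ S, |(k : ℝ)| ≤ 3 * R) {N : ℕ}
    (hN : 3 * R * X ≤ N) {E : Set (ℝ × ℤ)}
    (hE : ∀ x n, (x, n) ∈ E → ∀ t ∈ Set.Icc (n : ℝ) (n + h), (x, t) ∈ planarAnnulus R) :
    ENNReal.ofReal (R ^ 2 * h) * ∑' n : ℤ, ∫⁻ x, E.indicator
        (fun p ↦ ‖rayIntegral β (sliceFourier S g) (p.1, p.2)‖ₑ ^ 2) (x, n) ≤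
      ENNReal.ofReal (2400000 * B ^ 2 * N) * ∑ k ∈ S, ∫⁻ x, ‖g k x‖ₑ ^ 2 := by
  set F := sliceFourier S g with hFdef
  set g' : ℤ → ℝ → ℂ := fun k x ↦ (-(2 * π * Complex.I * k)) * g k x with hg'def
  set F' := sliceFourier S g' with hF'def
  have hgi : ∀ k ∈ S, Integrable (g' k) := fun k hk ↦ (hg k hk).const_mul _
  have hgi' : ∀ k ∈ S, MemLp (g' k) 2 := fun k hk ↦ (hg' k hk).const_mul _
  have hF : Continuous F := continuous_sliceFourier hg
  have hF' : Continuous F' := continuous_sliceFourier hgi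
  have hc := hβ.continuous_rayIntegral hF
  have hc1 := hβ.ofReal_mul.continuous_rayIntegral hF
  have hc2 := hβ.ofReal_mul.continuous_rayIntegral hF'
  set M := ∑ k ∈ S, ∫⁻ x, ‖g k x‖ₑ ^ 2 with hM
  set A := planarAnnulus R with hAdef
  have hAm : MeasurableSet A := measurableSet_planarAnnulus R
  obtain ⟨c1, hc1def⟩ : ∃ c, c = 4 * h ^ 2 * (12 * π * R) ^ 2 := ⟨_, rfl⟩
  obtain ⟨c2, hc2def⟩ : ∃ c, c = 4 * h ^ 2 := ⟨_, rfl⟩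
  set w : ℝ × ℝ → ℝ≥0∞ := A.indicator (fun y ↦ 2 * ‖rayIntegral β F y‖ₑ ^ 2 +
    (ENNReal.ofReal c1 * ‖rayIntegral (fun σ ↦ σ * β σ) F y‖ₑ ^ 2 +
      ENNReal.ofReal c2 * ‖rayIntegral (fun σ ↦ σ * β σ) F' y‖ₑ ^ 2)) with hw
  have hwm : Measurable w := Measurable.indicator (by fun_prop) hAm
  have hpt : ∀ n : ℤ, ∀ x : ℝ, ENNReal.ofReal h * E.indicator
      (fun p ↦ ‖rayIntegral β F (p.1, p.2)‖ₑ ^ 2) (x, n) ≤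
      ∫⁻ t in Set.Ioc (n : ℝ) (n + 1), w (x, t) := by
    intro n x
    by_cases hx : (x, n) ∈ E
    · rw [Set.indicator_of_mem hx, setLIntegral_congr (Ioc_ae_eq_Icc (a := (n : ℝ)))]
      rw [hw, hc1def, hc2def]
      refine (hβ.enorm_sq_rayIntegral_le hR h0 hF hF' (hasDerivAt_sliceFourier S g)
        (hE x n hx)).trans ?_
      exact lintegral_mono_set (Set.Icc_subset_Icc_right (by linarith))
    · rw [Set.indicator_of_notMem hx, mul_zero]
      exact zero_le
  have hstrip : ∀ f : ℝ × ℝ → ℝ≥0∞, ∫⁻ ξ in Set.univ ×ˢ Set.Icc (-(3 * R * X)) (3 * R * X), f ξ ≤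
      ∫⁻ ξ in Set.univ ×ˢ Set.Icc (-N : ℝ) N, f ξ := fun f ↦
    lintegral_mono_set (Set.prod_mono_right (Set.Icc_subset_Icc (by linarith) hN))
  have hM' : ∑ k ∈ S, ∫⁻ x, ‖g' k x‖ₑ ^ 2 ≤ ENNReal.ofReal ((6 * π * R) ^ 2) * M := by
    rw [hM, Finset.mul_sum]
    refine Finset.sum_le_sum fun k hk ↦ ?_
    rw [← lintegral_const_mul' _ _ ENNReal.ofReal_ne_top]
    refine lintegral_mono fun x ↦ ?_
    rw [hg'def, enorm_mul, mul_pow, ENNReal.ofReal_pow (by positivity)]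
    gcongr
    rw [← ofReal_norm]
    refine ENNReal.ofReal_le_ofReal ?_
    have := hS k hk
    simp only [norm_neg, norm_mul, Complex.norm_I, Complex.norm_real, Real.norm_eq_abs,
      abs_of_pos Real.pi_pos, mul_one, Complex.norm_ofNat, Complex.norm_intCast]
    nlinarith [Real.pi_pos]
  have a0 : ENNReal.ofReal (R ^ 2) * ∫⁻ y in A, ‖rayIntegral β F y‖ₑ ^ 2 ≤
      40 * ENNReal.ofReal (B ^ 2) * (2 * N * M) :=
    (hβ.annulus_estimate hX.le hR hF).trans (mul_le_mul' le_rfl ((hstrip _).trans_eq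
      (setLIntegral_enorm_sq_sliceFourier hg hg' N)))
  have a1 : ENNReal.ofReal (R ^ 2) * ∫⁻ y in A, ‖rayIntegral (fun σ ↦ σ * β σ) F y‖ₑ ^ 2 ≤
      40 * ENNReal.ofReal ((2 * X * B) ^ 2) * (2 * N * M) :=
    (hβ.ofReal_mul.annulus_estimate hX.le hR hF).trans (mul_le_mul' le_rfl ((hstrip _).trans_eq
      (setLIntegral_enorm_sq_sliceFourier hg hg' N)))
  have a2 : ENNReal.ofReal (R ^ 2) * ∫⁻ y in A, ‖rayIntegral (fun σ ↦ σ * β σ) F' y‖ₑ ^ 2 ≤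
      40 * ENNReal.ofReal ((2 * X * B) ^ 2) *
        (2 * N * (ENNReal.ofReal ((6 * π * R) ^ 2) * M)) :=
    (hβ.ofReal_mul.annulus_estimate hX.le hR hF').trans (mul_le_mul' le_rfl ((hstrip _).trans
      ((setLIntegral_enorm_sq_sliceFourier hgi hgi' N).trans_le (mul_le_mul' le_rfl hM'))))
  calc ENNReal.ofReal (R ^ 2 * h) * ∑' n : ℤ, ∫⁻ x, E.indicator
        (fun p ↦ ‖rayIntegral β F (p.1, p.2)‖ₑ ^ 2) (x, n)
      = ENNReal.ofReal (R ^ 2) * ∑' n : ℤ, ∫⁻ x, ENNReal.ofReal h * E.indicator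
          (fun p ↦ ‖rayIntegral β F (p.1, p.2)‖ₑ ^ 2) (x, n) := by
        rw [ENNReal.ofReal_mul (by positivity), mul_assoc, ← ENNReal.tsum_mul_left]
        simp only [lintegral_const_mul' _ _ ENNReal.ofReal_ne_top]
    _ ≤ ENNReal.ofReal (R ^ 2) * ∫⁻ y, w y := by
        refine mul_le_mul' le_rfl (le_trans ?_ (tsum_lintegral_setLIntegral_Ioc_le hwm))
        exact ENNReal.tsum_le_tsum fun n ↦ lintegral_mono (hpt n)
    _ = 2 * (ENNReal.ofReal (R ^ 2) * ∫⁻ y in A, ‖rayIntegral β F y‖ₑ ^ 2) +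
          (ENNReal.ofReal c1 * (ENNReal.ofReal (R ^ 2) *
            ∫⁻ y in A, ‖rayIntegral (fun σ ↦ σ * β σ) F y‖ₑ ^ 2) +
          ENNReal.ofReal c2 * (ENNReal.ofReal (R ^ 2) *
            ∫⁻ y in A, ‖rayIntegral (fun σ ↦ σ * β σ) F' y‖ₑ ^ 2)) := by
        rw [hw, lintegral_indicator hAm, lintegral_add_left (by fun_prop),
          lintegral_add_left (by fun_prop), lintegral_const_mul' _ _ (by finiteness),
          lintegral_const_mul' _ _ (by finiteness), lintegral_const_mul' _ _ (by finiteness)]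
        ring
    _ ≤ 2 * (40 * ENNReal.ofReal (B ^ 2) * (2 * N * M)) +
          (ENNReal.ofReal c1 * (40 * ENNReal.ofReal ((2 * X * B) ^ 2) * (2 * N * M)) +
          ENNReal.ofReal c2 * (40 * ENNReal.ofReal ((2 * X * B) ^ 2) *
            (2 * N * (ENNReal.ofReal ((6 * π * R) ^ 2) * M)))) := by gcongr
    _ = (ENNReal.ofReal (2 * (40 * B ^ 2 * (2 * N))) +
          (ENNReal.ofReal (c1 * (40 * (2 * X * B) ^ 2 * (2 * N))) +
          ENNReal.ofReal (c2 * (40 * (2 * X * B) ^ 2 * (2 * N * (6 * π * R) ^ 2))))) * M := by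
        have hN0 : (0 : ℝ) ≤ N := Nat.cast_nonneg N
        have e2 : (2 : ℝ≥0∞) = ENNReal.ofReal 2 := by simp
        have e40 : (40 : ℝ≥0∞) = ENNReal.ofReal 40 := by simp
        have eN : (N : ℝ≥0∞) = ENNReal.ofReal N := by simp
        have p1 : 0 ≤ c1 := hc1def ▸ by positivity
        have p2 : 0 ≤ c2 := hc2def ▸ by positivity
        rw [ENNReal.ofReal_mul zero_le_two, ENNReal.ofReal_mul (p := 40 * B ^ 2) (by positivity),
          ENNReal.ofReal_mul (p := 40) (by positivity), ENNReal.ofReal_mul (p := 2) (by positivity),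
          ENNReal.ofReal_mul p1, ENNReal.ofReal_mul (p := 40 * (2 * X * B) ^ 2) (by positivity),
          ENNReal.ofReal_mul (p := 40) (by positivity), ENNReal.ofReal_mul (p := 2) (by positivity),
          ENNReal.ofReal_mul p2, ENNReal.ofReal_mul (p := 40 * (2 * X * B) ^ 2) (by positivity),
          ENNReal.ofReal_mul (p := 40) (by positivity),
          ENNReal.ofReal_mul (p := 2 * N) (by positivity),
          ENNReal.ofReal_mul (p := 2) (by positivity),
          ← e2, ← e40, ← eN]
        ring
    _ ≤ _ := by
        have p1 : 0 ≤ c1 := hc1def ▸ by positivity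
        have p2 : 0 ≤ c2 := hc2def ▸ by positivity
        rw [← ENNReal.ofReal_add (by positivity) (by positivity),
          ← ENNReal.ofReal_add (by positivity) (by positivity)]
        gcongr
        have hπ : π ^ 2 ≤ 10 := by nlinarith [Real.pi_lt_d2, Real.pi_pos]
        have hq : (h * X * R) ^ 2 ≤ 1 := pow_le_one₀ (by positivity) hXR
        have hq2 : π ^ 2 * (h * X * R) ^ 2 ≤ 10 := by nlinarith [sq_nonneg π, sq_nonneg (h * X * R)]
        have : 2 * (40 * B ^ 2 * (2 * N)) + (c1 * (40 * (2 * X * B) ^ 2 * (2 * N)) +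
          c2 * (40 * (2 * X * B) ^ 2 * (2 * N * (6 * π * R) ^ 2))) =
            B ^ 2 * N * (160 + 230400 * (π ^ 2 * (h * X * R) ^ 2)) := by
          rw [hc1def, hc2def]; ring
        rw [this, show 2400000 * B ^ 2 * N = B ^ 2 * N * 2400000 by ring]
        gcongr
        linarith

theorem IsHalfSymbol.comp_mul {β : ℝ → ℂ} {B X a : ℝ} (hβ : IsHalfSymbol β B X) (ha : 0 < a) :
    IsHalfSymbol (fun σ ↦ β (a ^ 2 * σ)) (B * a) (X / a ^ 2) where
  contDiff := hβ.contDiff.comp (contDiff_const.mul contDiff_id)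
  eq_zero σ hσ := by
    refine hβ.eq_zero _ fun h ↦ hσ ?_
    have h2 : |a ^ 2 * σ| ≤ X := abs_le.2 h
    rw [abs_mul, abs_of_pos (by positivity)] at h2
    exact abs_le.1 ((le_div_iff₀' (by positivity)).2 h2)
  bound σ := by
    have := hβ.bound (a ^ 2 * σ)
    rw [abs_mul, abs_of_pos (by positivity)] at this
    linarith
  bound_deriv σ := by
    have h1 : HasDerivAt (fun σ : ℝ ↦ a ^ 2 * σ) (a ^ 2) σ := by
      simpa using (hasDerivAt_id σ).const_mul (a ^ 2)
    have h2 := (((hβ.contDiff.differentiable one_ne_zero) (a ^ 2 * σ)).hasDerivAt).scomp σ h1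
    have h3 := hβ.bound_deriv (a ^ 2 * σ)
    rw [abs_mul, abs_of_pos (by positivity)] at h3
    rw [show deriv (fun σ ↦ β (a ^ 2 * σ)) σ = _ from h2.deriv]
    have e : (σ : ℂ) * (a ^ 2 • deriv β (a ^ 2 * σ)) =
        ((a ^ 2 * σ : ℝ) : ℂ) * deriv β (a ^ 2 * σ) := by
      rw [Complex.real_smul]; push_cast; ring
    rw [e]
    linarith

/-- Removing the low frequencies of a symbol of order `1/2`. -/
theorem isHalfSymbol_mul_sq_div {b : ℝ → ℂ} {C₀ C₁ X : ℝ} (hb : ContDiff ℝ 1 b)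
    (hsupp : ∀ s ∉ Set.Icc (-X) X, b s = 0) (h0 : ∀ s, ‖b s‖ ^ 2 ≤ C₀ ^ 2 * (1 + |s|))
    (h1 : ∀ s, ‖s * deriv b s‖ ^ 2 ≤ C₁ ^ 2 * (1 + |s|)) :
    IsHalfSymbol (fun s ↦ ((s ^ 2 / (1 + s ^ 2) : ℝ) : ℂ) * b s) (2 * |C₁| + 4 * |C₀|) X := by
  have hpos : ∀ s : ℝ, 0 < 1 + s ^ 2 := fun s ↦ by positivity
  have key : ∀ s : ℝ, (s ^ 2 / (1 + s ^ 2)) ^ 2 * (1 + |s|) ≤ 2 * |s| := by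
    intro s
    have hu : s ^ 2 / (1 + s ^ 2) ≤ 1 := (div_le_one (hpos s)).2 (by linarith)
    have hu0 : 0 ≤ s ^ 2 / (1 + s ^ 2) := by positivity
    calc (s ^ 2 / (1 + s ^ 2)) ^ 2 * (1 + |s|) ≤ s ^ 2 / (1 + s ^ 2) * (1 + |s|) := by
          gcongr; nlinarith
      _ ≤ 2 * |s| := by
          rw [div_mul_eq_mul_div, div_le_iff₀ (hpos s), ← sq_abs s]
          nlinarith [mul_nonneg (abs_nonneg s) (sq_nonneg (|s| - 1)), abs_nonneg s,
            mul_nonneg (abs_nonneg s) (sq_nonneg |s|)]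
  refine ⟨?_, fun s hs ↦ by simp [hsupp s hs], fun s ↦ ?_, fun s ↦ ?_⟩
  · refine ContDiff.mul (Complex.ofRealCLM.contDiff.comp ?_) hb
    exact (contDiff_id.pow 2).div (contDiff_const.add (contDiff_id.pow 2)) fun s ↦ (hpos s).ne'
  · rw [norm_mul, mul_pow, Complex.norm_real, Real.norm_eq_abs, sq_abs]
    have h2 := mul_le_mul_of_nonneg_left (h0 s) (sq_nonneg (s ^ 2 / (1 + s ^ 2)))
    have h3 := mul_le_mul_of_nonneg_left (key s) (sq_nonneg C₀)
    rw [← sq_abs C₀] at h2 h3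
    have h4 : 2 * |C₀| ^ 2 * |s| ≤ (2 * |C₁| + 4 * |C₀|) ^ 2 * |s| := by
      gcongr
      nlinarith [abs_nonneg C₁, abs_nonneg C₀, mul_nonneg (abs_nonneg C₁) (abs_nonneg C₀)]
    nlinarith
  · have hu : HasDerivAt (fun s : ℝ ↦ s ^ 2 / (1 + s ^ 2)) (2 * s / (1 + s ^ 2) ^ 2) s := by
      have := (hasDerivAt_pow 2 s).div ((hasDerivAt_pow 2 s).const_add 1) (hpos s).ne'
      convert! this using 1
      congr 1
      push_cast
      ring
    have hd := (hu.ofReal_comp).fun_mul ((hb.differentiable one_ne_zero) s).hasDerivAt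
    rw [hd.deriv]
    set u := s ^ 2 / (1 + s ^ 2) with hudef
    have hu0 : 0 ≤ u := by positivity
    set v := s * (2 * s / (1 + s ^ 2) ^ 2) with hvdef
    have hv0 : 0 ≤ v := by
      rw [hvdef, ← mul_div_assoc, show s * (2 * s) = 2 * s ^ 2 by ring]
      positivity
    have hvu : v ≤ 2 * u := by
      rw [hvdef, hudef, ← mul_div_assoc, ← mul_div_assoc, div_le_div_iff₀ (by positivity) (hpos s)]
      nlinarith [mul_nonneg (sq_nonneg s) (sq_nonneg (1 + s ^ 2)), sq_nonneg s,
        mul_nonneg (sq_nonneg s) (mul_nonneg (sq_nonneg s) (hpos s).le)]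
    have e : (s : ℂ) * (((2 * s / (1 + s ^ 2) ^ 2 : ℝ) : ℂ) * b s + (u : ℂ) * deriv b s) =
        (v : ℂ) * b s + (u : ℂ) * (s * deriv b s) := by
      rw [hvdef]; push_cast; ring
    rw [e]
    have n1 : ‖b s‖ ≤ |C₀| * √(1 + |s|) := by
      refine le_of_sq_le_sq ?_ (by positivity)
      rw [mul_pow, Real.sq_sqrt (by positivity), sq_abs]
      exact h0 s
    have n2 : ‖s * deriv b s‖ ≤ |C₁| * √(1 + |s|) := by
      refine le_of_sq_le_sq ?_ (by positivity)
      rw [mul_pow, Real.sq_sqrt (by positivity), sq_abs]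
      exact h1 s
    have n3 : ‖(v : ℂ) * b s + (u : ℂ) * (s * deriv b s)‖ ≤
        (|C₁| + 2 * |C₀|) * (u * √(1 + |s|)) := by
      refine (norm_add_le _ _).trans ?_
      rw [norm_mul, norm_mul, Complex.norm_real, Complex.norm_real, Real.norm_of_nonneg hu0,
        Real.norm_of_nonneg hv0]
      calc v * ‖b s‖ + u * ‖s * deriv b s‖
          ≤ 2 * u * (|C₀| * √(1 + |s|)) + u * (|C₁| * √(1 + |s|)) := by gcongr
        _ = _ := by ring
    calc ‖(v : ℂ) * b s + (u : ℂ) * (s * deriv b s)‖ ^ 2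
        ≤ ((|C₁| + 2 * |C₀|) * (u * √(1 + |s|))) ^ 2 := by gcongr
      _ = (|C₁| + 2 * |C₀|) ^ 2 * (u ^ 2 * (1 + |s|)) := by
          rw [mul_pow, mul_pow, Real.sq_sqrt (by positivity)]
      _ ≤ (|C₁| + 2 * |C₀|) ^ 2 * (2 * |s|) := mul_le_mul_of_nonneg_left (key s) (sq_nonneg _)
      _ ≤ _ := by nlinarith [mul_nonneg (sq_nonneg (|C₁| + 2 * |C₀|)) (abs_nonneg s)]

theorem integrable_one_add_abs_rpow : Integrable fun s : ℝ ↦ 2 * (1 + |s|) ^ (-(3 / 2) : ℝ) := by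
  have := integrable_one_add_norm (E := ℝ) (μ := volume) (r := 3 / 2) (by norm_num)
  exact this.const_mul 2

/-- The low-frequency part of a symbol of order `1/2` is dominated by an integrable function. -/
theorem norm_inv_one_add_sq_mul_le {z : ℂ} {C s : ℝ} (hz : ‖z‖ ≤ C * (1 + |s|) ^ (1 / 2 : ℝ)) :
    ‖(((1 + s ^ 2)⁻¹ : ℝ) : ℂ) * z‖ ≤ C * (2 * (1 + |s|) ^ (-(3 / 2) : ℝ)) := by
  have hp : 0 < 1 + |s| := by positivity
  have hq : 0 < 1 + s ^ 2 := by positivity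
  rw [norm_mul, Complex.norm_real, Real.norm_of_nonneg (by positivity)]
  have h1 : (1 + s ^ 2)⁻¹ ≤ 2 * (1 + |s|) ^ (-2 : ℝ) := by
    rw [Real.rpow_neg hp.le, Real.rpow_two, inv_le_iff_one_le_mul₀ hq, mul_comm, ← mul_assoc,
      ← div_eq_mul_inv, le_div_iff₀ (by positivity)]
    nlinarith [sq_nonneg (|s| - 1), sq_abs s]
  have h2 : (1 + |s|) ^ (-(3 / 2) : ℝ) = (1 + |s|) ^ (-2 : ℝ) * (1 + |s|) ^ (1 / 2 : ℝ) := by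
    rw [← Real.rpow_add hp]; norm_num
  rw [h2]
  calc (1 + s ^ 2)⁻¹ * ‖z‖ ≤ (2 * (1 + |s|) ^ (-2 : ℝ)) * (C * (1 + |s|) ^ (1 / 2 : ℝ)) := by
        gcongr
    _ = _ := by ring

theorem eLpNorm_two_sq {α : Type*} [MeasurableSpace α] (μ : Measure α) (f : α → ℂ) :
    eLpNorm f 2 μ ^ 2 = ∫⁻ x, ‖f x‖ₑ ^ 2 ∂μ := by
  have := eLpNorm_nnreal_pow_eq_lintegral (f := f) (μ := μ) (p := 2) two_ne_zero
  simpa using this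

theorem lintegral_muZ {f : ℝ × ℤ → ℝ≥0∞} (hf : AEMeasurable f muZ) :
    ∫⁻ p, f p ∂muZ = ∑' n : ℤ, ∫⁻ x, f (x, n) := by
  rw [muZ, lintegral_prod_symm _ hf, lintegral_count]

theorem integral_muZ {f : ℝ × ℤ → ℂ} (hf : Integrable f muZ) {S : Finset ℤ}
    (hS : ∀ x, ∀ n ∉ S, f (x, n) = 0) : ∫ p, f p ∂muZ = ∑ n ∈ S, ∫ x, f (x, n) := by
  rw [muZ] at hf ⊢
  rw [integral_prod_symm _ hf, integral_countable hf.integral_prod_right,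
    tsum_eq_sum (s := S) fun n hn ↦ by simp [hS _ n hn]]
  simp

theorem integrable_slice_of_muZ {f : ℝ × ℤ → ℂ} (hf : Integrable f muZ) (n : ℤ) :
    Integrable fun x ↦ f (x, n) := by
  rw [muZ] at hf
  exact Measure.ae_count_iff.1 hf.prod_left_ae n

theorem memLp_slice_of_muZ {f : ℝ × ℤ → ℂ} (hf : Integrable f muZ) (hf2 : MemLp f 2 muZ) (n : ℤ) :
    MemLp (fun x ↦ f (x, n)) 2 := by
  refine ⟨(integrable_slice_of_muZ hf n).1, ?_⟩
  have h1 : ∑' n : ℤ, ∫⁻ x, ‖f (x, n)‖ₑ ^ 2 < ⊤ := by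
    rw [← lintegral_muZ (hf.1.enorm.pow_const 2), ← eLpNorm_two_sq]
    exact ENNReal.pow_lt_top hf2.2
  have h2 := (ENNReal.le_tsum n).trans_lt h1
  rw [← eLpNorm_two_sq] at h2
  exact (ENNReal.pow_lt_top_iff.1 h2).resolve_right two_ne_zero

/-- An integral operator with a kernel continuous in the second variable is controlled by its
action on a truncation of the given function which is almost everywhere strongly measurable. -/
theorem exists_aestronglyMeasurable_enorm_integral_le {α ι : Type*} [TopologicalSpace α]
    [SecondCountableTopology α] [MeasurableSpace α] [BorelSpace α] (μ : Measure α)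
    {K : ι → α → ℂ} (hK : ∀ i, Continuous (K i)) (G : α → ℂ) :
    ∃ G' : α → ℂ, AEStronglyMeasurable G' μ ∧ (∀ w, ‖G' w‖ₑ ≤ ‖G w‖ₑ) ∧
      ∀ i, ‖∫ w, K i w * G w ∂μ‖ₑ ≤ ‖∫ w, K i w * G' w ∂μ‖ₑ := by
  set I : Set ι := {i | AEStronglyMeasurable (fun w ↦ K i w * G w) μ} with hI
  have hopen : ∀ i, IsOpen {w | K i w ≠ 0} := fun i ↦ (hK i).isOpen_preimage _ isOpen_ne
  obtain ⟨T, hTI, hT, hU⟩ := TopologicalSpace.isOpen_biUnion_countable I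
    (fun i ↦ {w | K i w ≠ 0}) fun i _ ↦ hopen i
  set A := ⋃ i ∈ I, {w | K i w ≠ 0} with hA
  have hAm : MeasurableSet A := (isOpen_biUnion fun i _ ↦ hopen i).measurableSet
  refine ⟨A.indicator G, ?_, fun w ↦ ?_, fun i ↦ ?_⟩
  · rw [aestronglyMeasurable_indicator_iff hAm, ← hU]
    have := hT.to_subtype
    rw [Set.biUnion_eq_iUnion, aestronglyMeasurable_iUnion_iff]
    rintro ⟨i, hi⟩
    have h1 : AEStronglyMeasurable (fun w ↦ (K i w)⁻¹ * (K i w * G w)) μ :=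
      ((hK i).measurable.inv.aestronglyMeasurable).mul (hTI hi)
    refine (h1.mono_measure Measure.restrict_le_self).congr ?_
    filter_upwards [ae_restrict_mem (hopen i).measurableSet] with w hw
    exact inv_mul_cancel_left₀ hw _
  · by_cases hw : w ∈ A
    · rw [Set.indicator_of_mem hw]
    · rw [Set.indicator_of_notMem hw, enorm_zero]
      exact zero_le
  · by_cases hi : i ∈ I
    · refine le_of_eq ?_
      congr 2
      funext w
      by_cases hw : w ∈ A
      · rw [Set.indicator_of_mem hw]
      · have : K i w = 0 := by
          by_contra h
          exact hw (Set.mem_biUnion hi h)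
        rw [this, zero_mul, zero_mul]
    · rw [integral_non_aestronglyMeasurable hi, enorm_zero]
      exact zero_le

@[fun_prop]
theorem continuous_dotZ : Continuous fun p : (ℝ × ℤ) × (ℝ × ℤ) ↦ dotZ p.1 p.2 := by
  have : Continuous fun k : ℤ ↦ (k : ℝ) := continuous_of_discreteTopology
  unfold dotZ
  fun_prop

instance : SFinite muZ := by unfold muZ; infer_instance

/-- The oscillatory operator with amplitude `β` factors through `rayIntegral`. -/
theorem integral_oscillatory_eq_rayIntegral {β : ℝ → ℂ} (hβi : Integrable β)
    {f : ℝ × ℤ → ℂ} (hf : Integrable f muZ) {S : Finset ℤ} (hS : ∀ x, ∀ k ∉ S, f (x, k) = 0)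
    (y : ℝ × ℤ) :
    ∫ w, (∫ σ, unitExp (σ * dotZ (y - w) y) * β σ) * f w ∂muZ =
      rayIntegral β (sliceFourier S fun k x ↦ f (x, k)) (y.1, y.2) := by
  have hprod : Integrable (Function.uncurry fun (w : ℝ × ℤ) (σ : ℝ) ↦
      unitExp (σ * dotZ (y - w) y) * (f w * β σ)) (muZ.prod volume) := by
    refine (hf.mul_prod hβi).bdd_mul (c := 1) ?_ (.of_forall fun p ↦ (norm_unitExp _).le)
    refine Continuous.aestronglyMeasurable ?_
    exact continuous_unitExp.comp (continuous_snd.mul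
      (continuous_dotZ.comp ((continuous_const.sub continuous_fst).prodMk continuous_const)))
  have h1 : ∀ w, (∫ σ, unitExp (σ * dotZ (y - w) y) * β σ) * f w =
      ∫ σ, unitExp (σ * dotZ (y - w) y) * (f w * β σ) := by
    intro w
    rw [← integral_mul_const]
    refine integral_congr_ae (.of_forall fun σ ↦ ?_)
    ring
  simp only [h1]
  rw [integral_integral_swap hprod, rayIntegral]
  refine integral_congr_ae (.of_forall fun σ ↦ ?_)
  simp only
  have h2 : Integrable (fun w : ℝ × ℤ ↦ unitExp (σ * dotZ (y - w) y) * (f w * β σ)) muZ := by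
    refine (hf.mul_const (β σ)).bdd_mul (c := 1) ?_ (.of_forall fun p ↦ (norm_unitExp _).le)
    refine Continuous.aestronglyMeasurable ?_
    exact continuous_unitExp.comp (continuous_const.mul
      (continuous_dotZ.comp ((continuous_const.sub continuous_id).prodMk continuous_const)))
  rw [integral_muZ h2 (S := S) fun x n hn ↦ by rw [hS x n hn]; ring, sliceFourier,
    Finset.mul_sum, Finset.mul_sum]
  refine Finset.sum_congr rfl fun k _ ↦ ?_
  rw [fourier_eq_integral_unitExp, ← integral_const_mul, ← integral_const_mul,
    ← integral_const_mul]
  refine integral_congr_ae (.of_forall fun x ↦ ?_)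
  simp only [dotZ, Prod.fst_sub, Prod.snd_sub, Int.cast_sub]
  rw [show σ * ((y.1 - x) * y.1 + ((y.2 : ℝ) - k) * y.2) =
    σ * (y.1 ^ 2 + (y.2 : ℝ) ^ 2) + (-(k * (σ * y.2)) + -(x * (σ * y.1))) by ring,
    unitExp_add, unitExp_add]
  ring

theorem IsHalfSymbol.integrable {β : ℝ → ℂ} {B X : ℝ} (hβ : IsHalfSymbol β B X) : Integrable β :=
  hβ.continuous.integrable_of_hasCompactSupport (HasCompactSupport.intro isCompact_Icc hβ.eq_zero)

/-- The `L²` estimate for the high-frequency part of the operator. -/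
theorem IsHalfSymbol.lintegral_oscillatory_le {β : ℝ → ℂ} {A δ R : ℝ} (hδ : 0 < δ) (hR : δ ≤ R)
    (hβ : IsHalfSymbol β (A * δ) (1 / (4 * δ))) {f : ℝ × ℤ → ℂ} (hf : Integrable f muZ)
    (hf2 : MemLp f 2 muZ) {S : Finset ℤ} (hfS : ∀ x, ∀ k ∉ S, f (x, k) = 0)
    (hS : ∀ k ∈ S, |(k : ℝ)| ≤ 3 * R) {E : Set (ℝ × ℤ)} (hEm : MeasurableSet E)
    (hE : ∀ x n, (x, n) ∈ E → ∀ t ∈ Set.Icc (n : ℝ) (n + δ / R), (x, t) ∈ planarAnnulus R) :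
    ∫⁻ y in E, ‖∫ w, (∫ σ, unitExp (σ * dotZ (y - w) y) * β σ) * f w ∂muZ‖ₑ ^ 2 ∂muZ ≤
      ENNReal.ofReal (4800000 * A ^ 2) * ∫⁻ w, ‖f w‖ₑ ^ 2 ∂muZ := by
  have hR0 : 0 < R := hδ.trans_le hR
  have hgi : ∀ k ∈ S, Integrable (fun x ↦ f (x, k)) := fun k _ ↦ integrable_slice_of_muZ hf k
  have hmem : ∀ k ∈ S, MemLp (fun x ↦ f (x, k)) 2 := fun k _ ↦ memLp_slice_of_muZ hf hf2 k
  have hc := hβ.continuous_rayIntegral (continuous_sliceFourier hgi)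
  simp only [integral_oscillatory_eq_rayIntegral hβ.integrable hf hfS]
  set N := ⌈3 * R * (1 / (4 * δ))⌉₊ with hN
  have key := hβ.discrete_annulus_estimate (by positivity) hR0 (h := δ / R) (by positivity)
    ((div_le_one hR0).2 hR) (by field_simp; norm_num) hgi hmem hS (N := N) (Nat.le_ceil _) hE
  set P := rayIntegral β (sliceFourier S fun k x ↦ f (x, k)) with hP
  have hcast : Continuous fun k : ℤ ↦ (k : ℝ) := continuous_of_discreteTopology
  have hm : Measurable fun p : ℝ × ℤ ↦ ‖P (p.1, p.2)‖ₑ ^ 2 := by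
    have : Continuous fun p : ℝ × ℤ ↦ P (p.1, p.2) := by fun_prop
    exact this.measurable.enorm.pow_const 2
  rw [← lintegral_indicator hEm, lintegral_muZ (hm.indicator hEm).aemeasurable,
    lintegral_muZ (hf.1.enorm.pow_const 2), tsum_eq_sum (s := S) (f := fun n : ℤ ↦
      ∫⁻ x, ‖f (x, n)‖ₑ ^ 2) fun n hn ↦ by simp [hfS _ n hn]]
  set M := ∑ k ∈ S, ∫⁻ x, ‖f (x, k)‖ₑ ^ 2 with hM
  have hNR : (N : ℝ) * δ ≤ 2 * R := by
    have h1 := (Nat.ceil_lt_add_one (a := 3 * R * (1 / (4 * δ))) (by positivity)).le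
    calc (N : ℝ) * δ ≤ (3 * R * (1 / (4 * δ)) + 1) * δ := by gcongr
      _ = 3 / 4 * R + δ := by field_simp
      _ ≤ 2 * R := by linarith
  have e1 : R ^ 2 * (δ / R) = R * δ := by field_simp
  have h2 : ENNReal.ofReal (2400000 * (A * δ) ^ 2 * N) * M ≤
      ENNReal.ofReal (R * δ) * (ENNReal.ofReal (4800000 * A ^ 2) * M) := by
    rw [← mul_assoc, ← ENNReal.ofReal_mul (by positivity)]
    refine mul_le_mul' (ENNReal.ofReal_le_ofReal ?_) le_rfl
    calc 2400000 * (A * δ) ^ 2 * N = 2400000 * A ^ 2 * δ * (N * δ) := by ring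
      _ ≤ 2400000 * A ^ 2 * δ * (2 * R) := by gcongr
      _ = R * δ * (4800000 * A ^ 2) := by ring
  rw [e1] at key
  exact (ENNReal.mul_le_mul_iff_right (by simp; positivity) ENNReal.ofReal_ne_top).1 (key.trans h2)

theorem continuous_integral_unitExp_mul {b : ℝ → ℂ} (hb : Integrable b) :
    Continuous fun t : ℝ ↦ ∫ s, unitExp (s * t) * b s := by
  refine continuous_of_dominated (bound := fun s ↦ ‖b s‖) (fun t ↦ ?_) (fun t ↦ ?_) hb.norm ?_
  · exact (continuous_unitExp.comp (by fun_prop)).aestronglyMeasurable.mul hb.1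
  · exact .of_forall fun s ↦ by simp [norm_unitExp]
  · exact .of_forall fun s ↦ (continuous_unitExp.comp (by fun_prop)).mul continuous_const

theorem norm_integral_unitExp_mul_le (b : ℝ → ℂ) (t : ℝ) :
    ‖∫ s, unitExp (s * t) * b s‖ ≤ ∫ s, ‖b s‖ :=
  (norm_integral_le_integral_norm _).trans_eq (by simp [norm_unitExp])

theorem integrable_unitExp_mul {b : ℝ → ℂ} (hb : Integrable b) (t : ℝ) :
    Integrable fun s ↦ unitExp (s * t) * b s :=
  hb.bdd_mul (c := 1) (continuous_unitExp.comp (by fun_prop)).aestronglyMeasurable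
    (.of_forall fun s ↦ (norm_unitExp _).le)

/-- A kernel bounded by `L` acts on `L²` of a set of finite measure. -/
theorem setLIntegral_enorm_integral_mul_sq_le {α : Type*} [MeasurableSpace α] {μ : Measure α}
    {E : Set α} {k : α → α → ℂ} {L : ℝ} (hk : ∀ y w, ‖k y w‖ ≤ L)
    {f : α → ℂ} (hf : AEStronglyMeasurable f μ) (hfE : ∀ w ∉ E, f w = 0) :
    ∫⁻ y in E, ‖∫ w, k y w * f w ∂μ‖ₑ ^ 2 ∂μ ≤
      (ENNReal.ofReal L * μ E) ^ 2 * ∫⁻ w, ‖f w‖ₑ ^ 2 ∂μ := by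
  have hfi : ∫⁻ w, ‖f w‖ₑ ∂μ = ∫⁻ w in E, ‖f w‖ₑ ∂μ := by
    refine (setLIntegral_eq_of_support_subset ?_).symm
    intro w hw
    by_contra h
    exact hw (by simp [hfE w h])
  have hpt : ∀ y, ‖∫ w, k y w * f w ∂μ‖ₑ ^ 2 ≤
      ENNReal.ofReal L ^ 2 * (μ E * ∫⁻ w, ‖f w‖ₑ ^ 2 ∂μ) := by
    intro y
    calc ‖∫ w, k y w * f w ∂μ‖ₑ ^ 2 ≤ (∫⁻ w, ENNReal.ofReal L * ‖f w‖ₑ ∂μ) ^ 2 := by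
          gcongr
          refine (enorm_integral_le_lintegral_enorm _).trans (lintegral_mono fun w ↦ ?_)
          rw [enorm_mul, ← ofReal_norm (k y w)]
          gcongr
          exact hk y w
      _ = ENNReal.ofReal L ^ 2 * (∫⁻ w in E, ‖f w‖ₑ ∂μ) ^ 2 := by
          rw [lintegral_const_mul' _ _ ENNReal.ofReal_ne_top, mul_pow, hfi]
      _ ≤ _ := by
          gcongr
          refine (lintegral_sq_le_measure_mul (μ.restrict E) hf.restrict.enorm).trans ?_
          rw [Measure.restrict_apply_univ]
          gcongr
          exact Measure.restrict_le_self
  calc _ ≤ ∫⁻ y in E, ENNReal.ofReal L ^ 2 * (μ E * ∫⁻ w, ‖f w‖ₑ ^ 2 ∂μ) ∂μ :=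
        lintegral_mono hpt
    _ = _ := by rw [setLIntegral_const]; ring

/-- The set on which a cutoff adapted to `cube δ m n` may be nonzero. -/
def wideCube (δ : ℝ) (m n : ℤ) : Set (ℝ × ℤ) :=
  Set.Icc ((m - 1) * δ) ((m + 2) * δ) ×ˢ Set.Icc ⌈(n - 1) * δ⌉ ⌊(n + 2) * δ⌋

theorem measurableSet_wideCube (δ : ℝ) (m n : ℤ) : MeasurableSet (wideCube δ m n) :=
  measurableSet_Icc.prod measurableSet_Icc

theorem mem_wideCube {δ : ℝ} {m n : ℤ} {p : ℝ × ℤ} :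
    p ∈ wideCube δ m n ↔ ((m - 1) * δ ≤ p.1 ∧ p.1 ≤ (m + 2) * δ) ∧
      (n - 1) * δ ≤ (p.2 : ℝ) ∧ (p.2 : ℝ) ≤ (n + 2) * δ := by
  rw [wideCube, Set.mem_prod, Set.mem_Icc, Set.mem_Icc, Int.ceil_le, Int.le_floor]

theorem muZ_wideCube_le {δ : ℝ} (hδ : 1 ≤ δ) (m n : ℤ) :
    muZ (wideCube δ m n) ≤ ENNReal.ofReal (12 * δ ^ 2) := by
  have h1 : ((⌊(n + 2) * δ⌋ + 1 - ⌈(n - 1) * δ⌉ : ℤ) : ℝ) ≤ 4 * δ := by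
    push_cast
    linarith [Int.floor_le ((n + 2) * δ), Int.le_ceil ((n - 1) * δ)]
  have h2 : Measure.count (Set.Icc ⌈(n - 1) * δ⌉ ⌊(n + 2) * δ⌋) ≤ ENNReal.ofReal (4 * δ) := by
    rw [← Finset.coe_Icc, Measure.count_apply_finset, Int.card_Icc, ← ENNReal.ofReal_natCast]
    refine ENNReal.ofReal_le_ofReal ?_
    rw [← Int.cast_natCast, Int.toNat_eq_max]
    push_cast at h1 ⊢
    exact max_le h1 (by linarith)
  rw [muZ, wideCube, Measure.prod_prod, Real.volume_Icc,
    show 12 * δ ^ 2 = ((m + 2) * δ - (m - 1) * δ) * (4 * δ) by ring,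
    ENNReal.ofReal_mul (by nlinarith)]
  gcongr

theorem cutoff_eq_zero {ρ : ℝ → ℝ} (hρ : Function.support ρ ⊆ Set.Icc (-1 : ℝ) 2) {δ : ℝ}
    (hδ : 0 < δ) {m n : ℤ} {p : ℝ × ℤ} (hp : p ∉ wideCube δ m n) : cutoff ρ δ m n p = 0 := by
  contrapose! hp
  have h1 := hρ (left_ne_zero_of_mul hp)
  have h2 := hρ (right_ne_zero_of_mul hp)
  rw [Set.mem_Icc] at h1 h2
  have e : ∀ a c : ℝ, (a / δ - c) * δ = a - c * δ := fun a c ↦ by field_simp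
  have l1 := mul_le_mul_of_nonneg_right h1.1 hδ.le
  have l2 := mul_le_mul_of_nonneg_right h1.2 hδ.le
  have l3 := mul_le_mul_of_nonneg_right h2.1 hδ.le
  have l4 := mul_le_mul_of_nonneg_right h2.2 hδ.le
  rw [e] at l1 l2 l3 l4
  rw [mem_wideCube]
  exact ⟨⟨by linarith, by linarith⟩, by linarith, by linarith⟩

theorem continuous_cutoff {ρ : ℝ → ℝ} (hρ : Continuous ρ) (δ : ℝ) (m n : ℤ) :
    Continuous (cutoff ρ δ m n) := by
  have : Continuous fun k : ℤ ↦ (k : ℝ) := continuous_of_discreteTopology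
  unfold cutoff
  fun_prop

/-- A cube far from the origin lies, after widening, in an annulus. -/
theorem exists_wideCube_subset_planarAnnulus {δ : ℝ} (hδ : 1 ≤ δ) {m n : ℤ}
    (hfar : ∀ p ∈ cube δ m n, 16 * δ ≤ √(p.1 ^ 2 + (p.2 : ℝ) ^ 2)) :
    ∃ R, δ ≤ R ∧ ∀ x k, (x, k) ∈ wideCube δ m n →
      ∀ t ∈ Set.Icc (k : ℝ) (k + δ / R), (x, t) ∈ planarAnnulus R := by
  set k₀ : ℤ := ⌈n * δ⌉
  have hk1 : n * δ ≤ (k₀ : ℝ) := Int.le_ceil _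
  have hk2 : (k₀ : ℝ) < n * δ + 1 := Int.ceil_lt_add_one _
  have hp := hfar (m * δ, k₀) ⟨le_rfl, by simp only; linarith, hk1, by simp only; linarith⟩
  simp only at hp
  set r := √((m * δ) ^ 2 + (k₀ : ℝ) ^ 2)
  have hr : r ^ 2 = (m * δ) ^ 2 + (k₀ : ℝ) ^ 2 := Real.sq_sqrt (by positivity)
  refine ⟨r / 2, by linarith, fun x k hxk t ht ↦ ?_⟩
  obtain ⟨⟨h1, h2⟩, h3, h4⟩ := mem_wideCube.1 hxk
  simp only at h1 h2 h3 h4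
  have ht1 : δ / (r / 2) ≤ 1 := (div_le_one (by linarith)).2 (by linarith)
  obtain ⟨ht2, ht3⟩ := ht
  obtain ⟨u, hu⟩ : ∃ u, u = x - m * δ := ⟨_, rfl⟩
  obtain ⟨v, hv⟩ : ∃ v, v = t - k₀ := ⟨_, rfl⟩
  have hu2 : u ^ 2 ≤ (2 * δ) ^ 2 := sq_le_sq' (by linarith) (by linarith)
  have hv2 : v ^ 2 ≤ (3 * δ) ^ 2 := sq_le_sq' (by linarith) (by linarith)
  have hr2 : 256 * δ ^ 2 ≤ r ^ 2 := by nlinarith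
  have hdot : (m * δ * u + k₀ * v) ^ 2 ≤ (r ^ 2 / 4) ^ 2 := by
    have : (m * δ * u + k₀ * v) ^ 2 ≤ r ^ 2 * (u ^ 2 + v ^ 2) := by
      rw [hr]; nlinarith [sq_nonneg (m * δ * v - k₀ * u)]
    nlinarith [sq_nonneg r]
  have hdot' := abs_le_of_sq_le_sq' hdot (by positivity)
  rw [show x = m * δ + u by linarith, show t = k₀ + v by linarith]
  constructor <;> simp only <;> nlinarith [sq_nonneg u, sq_nonneg v]

theorem integrable_kernel_dotZ_mul {κ : ℝ → ℂ} (hκ : Continuous κ) {L : ℝ} (hL : ∀ t, ‖κ t‖ ≤ L)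
    {f : ℝ × ℤ → ℂ} (hf : Integrable f muZ) (y : ℝ × ℤ) :
    Integrable (fun w ↦ κ (dotZ (y - w) y) * f w) muZ := by
  refine hf.bdd_mul (c := L) ?_ (.of_forall fun _ ↦ hL _)
  exact (hκ.comp (continuous_dotZ.comp
    ((continuous_const.sub continuous_id).prodMk continuous_const))).aestronglyMeasurable

theorem continuous_integral_kernel_dotZ_mul {κ : ℝ → ℂ} (hκ : Continuous κ) {L : ℝ}
    (hL : ∀ t, ‖κ t‖ ≤ L) {f : ℝ × ℤ → ℂ} (hf : Integrable f muZ) :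
    Continuous fun y ↦ ∫ w, κ (dotZ (y - w) y) * f w ∂muZ := by
  refine continuous_of_dominated (bound := fun w ↦ L * ‖f w‖)
    (fun y ↦ (integrable_kernel_dotZ_mul hκ hL hf y).1) (fun y ↦ .of_forall fun w ↦ ?_)
    (hf.norm.const_mul L) (.of_forall fun w ↦ ?_)
  · rw [norm_mul]
    gcongr
    exact hL _
  · exact (hκ.comp (continuous_dotZ.comp
      ((continuous_id.sub continuous_const).prodMk continuous_id))).mul continuous_const

/-- Splitting of an oscillatory kernel into a rescaled high-frequency and a low-frequency part. -/
theorem mul_integral_unitExp_eq_add {δ : ℝ} (hδ : 0 < δ) {b : ℝ → ℂ}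
    (h₁ : Integrable fun s ↦ ((s ^ 2 / (1 + s ^ 2) : ℝ) : ℂ) * b s)
    (h₂ : Integrable fun s ↦ (((1 + s ^ 2)⁻¹ : ℝ) : ℂ) * b s) (t : ℝ) :
    ((δ ^ (-2 : ℝ) : ℝ) : ℂ) * ∫ s, unitExp (δ ^ (-2 : ℝ) * s * t) * b s =
      (∫ σ, unitExp (σ * t) *
        ((((δ ^ 2 * σ) ^ 2 / (1 + (δ ^ 2 * σ) ^ 2) : ℝ) : ℂ) * b (δ ^ 2 * σ))) +
      ((δ ^ (-2 : ℝ) : ℝ) : ℂ) *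
        ∫ s, unitExp (s * (δ ^ (-2 : ℝ) * t)) * ((((1 + s ^ 2)⁻¹ : ℝ) : ℂ) * b s) := by
  have hD : δ ^ (-2 : ℝ) = (δ ^ 2)⁻¹ := by
    rw [Real.rpow_neg hδ.le]
    norm_num
  have e1 : ∀ σ, unitExp (σ * t) = unitExp ((δ ^ 2 * σ) * (δ ^ (-2 : ℝ) * t)) := by
    intro σ
    rw [hD]
    congr 1
    field_simp
  have e2 := Measure.integral_comp_mul_left (fun s ↦ unitExp (s * (δ ^ (-2 : ℝ) * t)) *
    (((s ^ 2 / (1 + s ^ 2) : ℝ) : ℂ) * b s)) (δ ^ 2)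
  have e3 : (∫ σ, unitExp (σ * t) *
      ((((δ ^ 2 * σ) ^ 2 / (1 + (δ ^ 2 * σ) ^ 2) : ℝ) : ℂ) * b (δ ^ 2 * σ))) = _ :=
    (integral_congr_ae (.of_forall fun σ ↦ by simp only [e1 σ])).trans e2
  rw [e3, abs_of_pos (by positivity), Complex.real_smul, ← hD, ← mul_add,
    ← integral_add (integrable_unitExp_mul h₁ _) (integrable_unitExp_mul h₂ _)]
  congr 1
  refine integral_congr_ae (.of_forall fun s ↦ ?_)
  have h3 : ((s ^ 2 / (1 + s ^ 2) : ℝ) : ℂ) + (((1 + s ^ 2)⁻¹ : ℝ) : ℂ) = 1 := by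
    rw [← Complex.ofReal_add, ← Complex.ofReal_one]
    congr 1
    field_simp
    ring
  simp only
  rw [← mul_add, ← add_mul, h3, one_mul]
  ring_nf

/-- The `L²` estimate for the operator without cutoffs, acting on functions supported near a cube
far from the origin. -/
theorem lintegral_wideCube_oscillatory_le {δ C₀ C₁ : ℝ} (hδ : 1 ≤ δ) {m n : ℤ}
    (hfar : ∀ p ∈ cube δ m n, 16 * δ ≤ √(p.1 ^ 2 + (p.2 : ℝ) ^ 2)) {b : ℝ → ℂ}
    (hb : ContDiff ℝ 1 b) (hsupp : ∀ s ∉ Set.Icc (-(δ / 4)) (δ / 4), b s = 0)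
    (h0 : ∀ s, ‖b s‖ ≤ C₀ * (1 + |s|) ^ (1 / 2 : ℝ))
    (h1 : ∀ s, ‖deriv b s‖ ≤ C₁ * (1 + |s|) ^ (-(1 / 2) : ℝ)) {f : ℝ × ℤ → ℂ}
    (hf : Integrable f muZ) (hf2 : MemLp f 2 muZ) (hfE : ∀ w ∉ wideCube δ m n, f w = 0) :
    ∫⁻ y in wideCube δ m n, ‖∫ w, (((δ ^ (-2 : ℝ) : ℝ) : ℂ) *
        ∫ s, unitExp (δ ^ (-2 : ℝ) * s * dotZ (y - w) y) * b s) * f w ∂muZ‖ₑ ^ 2 ∂muZ ≤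
      ENNReal.ofReal (2 * (4800000 * (2 * |C₁| + 4 * |C₀|) ^ 2 +
        144 * (C₀ * ∫ s : ℝ, 2 * (1 + |s|) ^ (-(3 / 2) : ℝ)) ^ 2)) * ∫⁻ w, ‖f w‖ₑ ^ 2 ∂muZ := by
  have hδ0 : 0 < δ := by linarith
  have hD : δ ^ (-2 : ℝ) = (δ ^ 2)⁻¹ := by
    rw [Real.rpow_neg hδ0.le]
    norm_num
  have hD0 : 0 < δ ^ (-2 : ℝ) := by positivity
  obtain ⟨R, hδR, hR⟩ := exists_wideCube_subset_planarAnnulus hδ hfar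
  have hR0 : 0 < R := hδ0.trans_le hδR
  have hsq : ∀ s : ℝ, ((1 + |s|) ^ (1 / 2 : ℝ)) ^ 2 = 1 + |s| := fun s ↦ by
    rw [← Real.rpow_natCast, ← Real.rpow_mul (by positivity)]
    norm_num
  have hsq' : ∀ s : ℝ, |s| * (1 + |s|) ^ (-(1 / 2) : ℝ) ≤ (1 + |s|) ^ (1 / 2 : ℝ) := fun s ↦ by
    calc |s| * (1 + |s|) ^ (-(1 / 2) : ℝ) ≤ (1 + |s|) ^ (1 : ℝ) * (1 + |s|) ^ (-(1 / 2) : ℝ) := by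
          gcongr
          rw [Real.rpow_one]
          linarith
      _ = (1 + |s|) ^ (1 / 2 : ℝ) := by
          rw [← Real.rpow_add (by positivity)]
          norm_num
  have hhigh := isHalfSymbol_mul_sq_div (C₀ := C₀) (C₁ := C₁) hb hsupp
    (fun s ↦ by
      rw [← hsq s, ← mul_pow]
      exact pow_le_pow_left₀ (norm_nonneg _) (h0 s) 2)
    (fun s ↦ by
      have hC₁ : 0 ≤ C₁ := by simpa using (norm_nonneg _).trans (h1 0)
      rw [← hsq s, ← mul_pow]
      refine pow_le_pow_left₀ (norm_nonneg _) ?_ 2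
      rw [norm_mul, Complex.norm_real, Real.norm_eq_abs]
      calc |s| * ‖deriv b s‖ ≤ |s| * (C₁ * (1 + |s|) ^ (-(1 / 2) : ℝ)) := by gcongr; exact h1 s
        _ = C₁ * (|s| * (1 + |s|) ^ (-(1 / 2) : ℝ)) := by ring
        _ ≤ _ := by gcongr; exact hsq' s)
  have hβ := hhigh.comp_mul hδ0
  rw [show δ / 4 / δ ^ 2 = 1 / (4 * δ) by field_simp] at hβ
  have hlow : Integrable fun s ↦ (((1 + s ^ 2)⁻¹ : ℝ) : ℂ) * b s := by
    refine Continuous.integrable_of_hasCompactSupport ?_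
      (HasCompactSupport.intro isCompact_Icc fun s hs ↦ by rw [hsupp s hs, mul_zero])
    refine .mul (Complex.continuous_ofReal.comp ?_) hb.continuous
    exact Continuous.inv₀ (by fun_prop) fun s ↦ by positivity
  set L := ∫ s, ‖(((1 + s ^ 2)⁻¹ : ℝ) : ℂ) * b s‖ with hLdef
  have hL : L ≤ C₀ * ∫ s : ℝ, 2 * (1 + |s|) ^ (-(3 / 2) : ℝ) := by
    rw [← integral_const_mul]
    exact integral_mono hlow.norm (integrable_one_add_abs_rpow.const_mul _)
      fun s ↦ norm_inv_one_add_sq_mul_le (h0 s)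
  have hL0 : 0 ≤ L := integral_nonneg fun _ ↦ norm_nonneg _
  set κ₁ : ℝ → ℂ := fun t ↦ ∫ σ, unitExp (σ * t) *
    ((((δ ^ 2 * σ) ^ 2 / (1 + (δ ^ 2 * σ) ^ 2) : ℝ) : ℂ) * b (δ ^ 2 * σ)) with hκ₁
  set κ₂ : ℝ → ℂ := fun t ↦ ((δ ^ (-2 : ℝ) : ℝ) : ℂ) *
    ∫ s, unitExp (s * (δ ^ (-2 : ℝ) * t)) * ((((1 + s ^ 2)⁻¹ : ℝ) : ℂ) * b s) with hκ₂
  have hc₁ : Continuous κ₁ := continuous_integral_unitExp_mul hβ.integrable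
  have hc₂ : Continuous κ₂ := continuous_const.mul
    ((continuous_integral_unitExp_mul hlow).comp (continuous_const.mul continuous_id))
  have hb₁ : ∀ t, ‖κ₁ t‖ ≤ _ := norm_integral_unitExp_mul_le _
  have hb₂ : ∀ t, ‖κ₂ t‖ ≤ δ ^ (-2 : ℝ) * L := fun t ↦ by
    rw [norm_mul, Complex.norm_real, Real.norm_of_nonneg hD0.le]
    gcongr
    exact norm_integral_unitExp_mul_le _ _
  have hfS : ∀ x, ∀ k ∉ Finset.Icc ⌈(n - 1) * δ⌉ ⌊(n + 2) * δ⌋, f (x, k) = 0 := fun x k hk ↦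
    hfE _ fun h ↦ hk (Finset.mem_Icc.2 h.2)
  have hS : ∀ k ∈ Finset.Icc ⌈(n - 1) * δ⌉ ⌊(n + 2) * δ⌋, |(k : ℝ)| ≤ 3 * R := fun k hk ↦
    abs_snd_le_of_mem_planarAnnulus hR0 (hR (m * δ) k
      ⟨⟨by simp only; linarith, by simp only; linarith⟩, Finset.mem_Icc.1 hk⟩ k
      ⟨le_rfl, by linarith [div_pos hδ0 hR0]⟩)
  have high := hβ.lintegral_oscillatory_le hδ0 hδR hf hf2 hfS hS (measurableSet_wideCube δ m n) hR
  have low := setLIntegral_enorm_integral_mul_sq_le (μ := muZ) (E := wideCube δ m n)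
    (k := fun y w ↦ κ₂ (dotZ (y - w) y)) (fun y w ↦ hb₂ _) hf.1 hfE
  have hlow' : (ENNReal.ofReal (δ ^ (-2 : ℝ) * L) * muZ (wideCube δ m n)) ^ 2 ≤
      ENNReal.ofReal (144 * (C₀ * ∫ s : ℝ, 2 * (1 + |s|) ^ (-(3 / 2) : ℝ)) ^ 2) := by
    calc _ ≤ (ENNReal.ofReal (δ ^ (-2 : ℝ) * L) * ENNReal.ofReal (12 * δ ^ 2)) ^ 2 := by
          gcongr
          exact muZ_wideCube_le hδ m n
      _ = ENNReal.ofReal (144 * L ^ 2) := by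
          rw [← ENNReal.ofReal_mul (by positivity), ← ENNReal.ofReal_pow (by positivity), hD]
          congr 1
          field_simp
          norm_num
      _ ≤ _ := by gcongr
  have hmeas : Measurable fun y ↦ 2 * ‖∫ w, κ₁ (dotZ (y - w) y) * f w ∂muZ‖ₑ ^ 2 :=
    ((continuous_integral_kernel_dotZ_mul hc₁ hb₁ hf).measurable.enorm.pow_const 2).const_mul 2
  calc _ ≤ ∫⁻ y in wideCube δ m n, (2 * ‖∫ w, κ₁ (dotZ (y - w) y) * f w ∂muZ‖ₑ ^ 2 +
        2 * ‖∫ w, κ₂ (dotZ (y - w) y) * f w ∂muZ‖ₑ ^ 2) ∂muZ := by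
        refine lintegral_mono fun y ↦ ?_
        simp only [mul_integral_unitExp_eq_add hδ0 hhigh.integrable hlow]
        simp only [add_mul]
        rw [integral_add (integrable_kernel_dotZ_mul hc₁ hb₁ hf y)
          (integrable_kernel_dotZ_mul hc₂ hb₂ hf y), ← mul_add]
        exact (pow_le_pow_left' (enorm_add_le _ _) 2).trans (ENNReal.add_sq_le_two_mul _ _)
    _ ≤ 2 * (ENNReal.ofReal (4800000 * (2 * |C₁| + 4 * |C₀|) ^ 2) * ∫⁻ w, ‖f w‖ₑ ^ 2 ∂muZ) +
        2 * (ENNReal.ofReal (144 * (C₀ * ∫ s : ℝ, 2 * (1 + |s|) ^ (-(3 / 2) : ℝ)) ^ 2) *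
          ∫⁻ w, ‖f w‖ₑ ^ 2 ∂muZ) := by
        rw [lintegral_add_left hmeas, lintegral_const_mul' _ _ ENNReal.ofNat_ne_top,
          lintegral_const_mul' _ _ ENNReal.ofNat_ne_top]
        gcongr
        exact low.trans (by gcongr)
    _ = _ := by
        rw [ENNReal.ofReal_mul zero_le_two, ENNReal.ofReal_add (by positivity) (by positivity)]
        simp only [ENNReal.ofReal_ofNat]
        ring

theorem exists_abs_cutoff_le {ρ : ℝ → ℝ} (hρ : Continuous ρ)
    (hsupp : Function.support ρ ⊆ Set.Icc (-1 : ℝ) 2) :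
    ∃ M, ∀ δ m n p, |cutoff ρ δ m n p| ≤ M := by
  obtain ⟨M, hM⟩ := hρ.bounded_above_of_compact_support
    (HasCompactSupport.intro isCompact_Icc fun x hx ↦ by simpa using fun h ↦ hx (hsupp h))
  refine ⟨M * M, fun δ m n p ↦ ?_⟩
  rw [cutoff, abs_mul]
  exact mul_le_mul (hM _) (hM _) (abs_nonneg _) ((abs_nonneg _).trans (hM 0))

/-- The key `L²` estimate (Proposition 3.1): for `1 ≤ δ`, `Tδ ≤ c` small, `b` a
symbol of order `1/2` supported in `[-Tδ²/4, Tδ²/4]`, and `θ` a `δ`-cube at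
distance `≥ C₀δ` from the origin, the operator
`V(G)(y) = δ^{-2} ∬ e^{2πi δ^{-2} s (y-w)·y} b(s) χ_θ(y)χ_θ(w) G(w) ds dw`
is bounded on `L²(ℝ×ℤ)` uniformly in `δ, T, m, n`. -/
theorem keyL2estimate
    (ρ : ℝ → ℝ) (hρ : ContDiff ℝ (⊤ : ℕ∞) ρ)
    (hρsupp : Function.support ρ ⊆ Set.Icc (-1 : ℝ) 2)
    (hρ1 : ∀ x ∈ Set.Icc (0 : ℝ) 1, ρ x = 1)
    (Cb : ℕ → ℝ) :
    ∃ c C₀ C : ℝ, 0 < c ∧ 0 < C₀ ∧ 0 < C ∧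
      ∀ (δ T : ℝ) (m n : ℤ) (b : ℝ → ℂ) (G : ℝ × ℤ → ℂ),
        1 ≤ δ → 0 < T → T * δ ≤ c →
        ContDiff ℝ (⊤ : ℕ∞) b →
        Function.support b ⊆ Set.Icc (-(T * δ ^ 2 / 4)) (T * δ ^ 2 / 4) →
        (∀ (N : ℕ) (s : ℝ), ‖iteratedDeriv N b s‖ ≤ Cb N * (1 + |s|) ^ ((1 : ℝ) / 2 - N)) →
        (∀ p ∈ cube δ m n, C₀ * δ ≤ Real.sqrt (p.1 ^ 2 + (p.2 : ℝ) ^ 2)) →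
        eLpNorm
          (fun y : ℝ × ℤ =>
            ((δ ^ (-2 : ℝ) : ℝ) : ℂ) *
              ∫ w : ℝ × ℤ,
                (∫ s : ℝ,
                    Complex.exp (2 * (π : ℂ) * Complex.I *
                      ((δ ^ (-2 : ℝ) * s * dotZ (y - w) y : ℝ) : ℂ)) * b s) *
                  ((cutoff ρ δ m n y * cutoff ρ δ m n w : ℝ) : ℂ) * G w ∂muZ)
          2 muZ
          ≤ ENNReal.ofReal C * eLpNorm G 2 muZ := by
  obtain ⟨M, hM⟩ := exists_abs_cutoff_le hρ.continuous hρsupp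
  have hM0 : 0 ≤ M := (abs_nonneg _).trans (hM 0 0 0 0)
  set Q := 2 * (4800000 * (2 * |Cb 1| + 4 * |Cb 0|) ^ 2 +
    144 * (Cb 0 * ∫ s : ℝ, 2 * (1 + |s|) ^ (-(3 / 2) : ℝ)) ^ 2) with hQ
  have hQ0 : 0 ≤ Q := by positivity
  refine ⟨1, 16, M ^ 4 * Q + 1, one_pos, by norm_num, by positivity, ?_⟩
  intro δ T m n b G hδ hT hTδ hb hbsupp hbd hfar
  have hδ0 : 0 < δ := by linarith
  have hsupp : ∀ s ∉ Set.Icc (-(δ / 4)) (δ / 4), b s = 0 := by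
    intro s hs
    by_contra h
    obtain ⟨h1, h2⟩ := hbsupp h
    have h3 : T * δ ^ 2 / 4 ≤ δ / 4 := by nlinarith
    exact hs ⟨by linarith, by linarith⟩
  have hbi : Integrable b := hb.continuous.integrable_of_hasCompactSupport
    (HasCompactSupport.intro isCompact_Icc hsupp)
  have h0 : ∀ s, ‖b s‖ ≤ Cb 0 * (1 + |s|) ^ (1 / 2 : ℝ) := fun s ↦ by simpa using hbd 0 s
  have h1 : ∀ s, ‖deriv b s‖ ≤ Cb 1 * (1 + |s|) ^ (-(1 / 2) : ℝ) := fun s ↦ by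
    have h := hbd 1 s
    rw [iteratedDeriv_one] at h
    norm_num at h ⊢
    exact h
  set χ := cutoff ρ δ m n with hχ
  have hχc : Continuous χ := continuous_cutoff hρ.continuous δ m n
  have hχ0 : ∀ p ∉ wideCube δ m n, χ p = 0 := fun p ↦ cutoff_eq_zero hρsupp hδ0
  set D : ℂ := ((δ ^ (-2 : ℝ) : ℝ) : ℂ)
  set κ : ℝ → ℂ := fun t ↦ ∫ s, unitExp (δ ^ (-2 : ℝ) * s * t) * b s with hκ
  have hκc : Continuous κ := by
    have := (continuous_integral_unitExp_mul hbi).comp (continuous_const_mul (δ ^ (-2 : ℝ)))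
    refine this.congr fun t ↦ ?_
    simp only [Function.comp_apply, hκ]
    refine integral_congr_ae (.of_forall fun s ↦ ?_)
    ring_nf
  obtain ⟨G', hG'm, hG'le, hG'⟩ := exists_aestronglyMeasurable_enorm_integral_le muZ
    (K := fun y w ↦ κ (dotZ (y - w) y) * ((χ y * χ w : ℝ) : ℂ)) (fun y ↦
      (hκc.comp (continuous_dotZ.comp
        ((continuous_const.sub continuous_id).prodMk continuous_const))).mul
        (Complex.continuous_ofReal.comp (continuous_const.mul hχc))) G
  have hGG : eLpNorm G' 2 muZ ≤ eLpNorm G 2 muZ := eLpNorm_mono_enorm hG'le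
  rcases eq_or_ne (eLpNorm G' 2 muZ) ∞ with htop | htop
  · rw [htop, top_le_iff] at hGG
    rw [hGG, ENNReal.mul_top (by simp; positivity)]
    exact le_top
  have hG'2 : MemLp G' 2 muZ := ⟨hG'm, htop.lt_top⟩
  set f : ℝ × ℤ → ℂ := fun w ↦ (χ w : ℂ) * G' w with hf
  have hfE : ∀ w ∉ wideCube δ m n, f w = 0 := fun w hw ↦ by simp [hf, hχ0 w hw]
  have hχn : ∀ w, ‖(χ w : ℂ)‖ₑ ≤ ENNReal.ofReal M := fun w ↦ by
    rw [← ofReal_norm, Complex.norm_real]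
    exact ENNReal.ofReal_le_ofReal (hM δ m n w)
  have hf2 : MemLp f 2 muZ := by
    refine hG'2.of_le_mul (c := M)
      ((Complex.continuous_ofReal.comp hχc).aestronglyMeasurable.mul hG'm) (.of_forall fun w ↦ ?_)
    rw [norm_mul, Complex.norm_real]
    gcongr
    exact hM δ m n w
  have hfi : Integrable f muZ := by
    have hfin : muZ (wideCube δ m n) ≠ ∞ :=
      ((muZ_wideCube_le hδ m n).trans_lt ENNReal.ofReal_lt_top).ne
    have : Fact (muZ (wideCube δ m n) < ∞) := ⟨hfin.lt_top⟩
    have h2 : IntegrableOn f (wideCube δ m n) muZ :=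
      memLp_one_iff_integrable.1 ((hf2.restrict _).mono_exponent one_le_two)
    exact (integrableOn_iff_integrable_of_support_subset fun w hw ↦ by
      by_contra h
      exact hw (hfE w h)).1 h2
  have main := lintegral_wideCube_oscillatory_le hδ hfar (hb.of_le (by simp)) hsupp h0 h1
    hfi hf2 hfE
  rw [← hQ] at main
  refine le_trans ?_ (mul_le_mul_right hGG _)
  refine (ENNReal.pow_le_pow_left_iff two_ne_zero).1 ?_
  rw [mul_pow, eLpNorm_two_sq, eLpNorm_two_sq]
  calc _ ≤ ∫⁻ y, (wideCube δ m n).indicator (fun y ↦ ENNReal.ofReal M ^ 2 *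
        ‖∫ w, (D * κ (dotZ (y - w) y)) * f w ∂muZ‖ₑ ^ 2) y ∂muZ := by
        refine lintegral_mono fun y ↦ ?_
        calc _ ≤ ‖D * ∫ w, κ (dotZ (y - w) y) * ((χ y * χ w : ℝ) : ℂ) * G' w ∂muZ‖ₑ ^ 2 := by
              rw [enorm_mul, enorm_mul]
              gcongr
              exact hG' y
          _ = (‖(χ y : ℂ)‖ₑ * ‖∫ w, (D * κ (dotZ (y - w) y)) * f w ∂muZ‖ₑ) ^ 2 := by
              rw [← enorm_mul, ← integral_const_mul, ← integral_const_mul]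
              congr 2
              refine integral_congr_ae (.of_forall fun w ↦ ?_)
              simp only [hf]
              push_cast
              ring
          _ ≤ _ := by
              by_cases hy : y ∈ wideCube δ m n
              · rw [Set.indicator_of_mem hy, mul_pow]
                gcongr
                exact hχn y
              · simp [hχ0 y hy]
    _ ≤ ENNReal.ofReal M ^ 2 * (ENNReal.ofReal Q * ∫⁻ w, ‖f w‖ₑ ^ 2 ∂muZ) := by
        rw [lintegral_indicator (measurableSet_wideCube δ m n),
          lintegral_const_mul' _ _ (by simp)]
        gcongr
    _ ≤ ENNReal.ofReal M ^ 2 * (ENNReal.ofReal Q *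
        (ENNReal.ofReal M ^ 2 * ∫⁻ w, ‖G' w‖ₑ ^ 2 ∂muZ)) := by
        rw [← lintegral_const_mul' (ENNReal.ofReal M ^ 2) _ (by simp)]
        gcongr with w
        rw [← mul_pow, hf, enorm_mul]
        gcongr
        exact hχn w
    _ = ENNReal.ofReal (M ^ 4 * Q) * ∫⁻ w, ‖G' w‖ₑ ^ 2 ∂muZ := by
        rw [ENNReal.ofReal_mul (p := M ^ 4) (by positivity), ENNReal.ofReal_pow hM0]
        ring
    _ ≤ _ := by
        rw [← ENNReal.ofReal_pow (by positivity)]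
        gcongr
        nlinarith [mul_nonneg (pow_nonneg hM0 4) hQ0]
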